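/- arXiv:1206.5896 — 6 statements merged into one kernel-verified Lean document; each statement's English description precedes it below -/
import Mathlib

section
/- Let K be a field, let u, v ∈ K with u ≠ v, and let m ≥ 0 be an integer. Then u^{m+1}(u+v)/(u−v)² + 3v^{m+1}/(v−u) − 2v^{m+2}/(v−u)² + 2m·v^{m+1}/(v−u) = Σ_{k=0}^{m} (2k+1)·u^{m−k}·v^{k}. -/
theorem sq_sub_mul_sum_odd_mul_pow {R : Type*} [CommRing R] (u v : R) (m : ℕ) :
    (u - v) ^ 2 * ∑ k ∈ Finset.range (m + 1), (2 * (k : R) + 1) * u ^ (m - k) * v ^ k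
    = u ^ (m + 1) * (u + v) - (2 * (m : R) + 3) * v ^ (m + 1) * (u - v) - 2 * v ^ (m + 2) := by
  induction m with
  | zero => simp; ring
  | succ m ih =>
    have step : ∑ k ∈ Finset.range (m + 1), (2 * (k : R) + 1) * u ^ (m + 1 - k) * v ^ k
        = u * ∑ k ∈ Finset.range (m + 1), (2 * (k : R) + 1) * u ^ (m - k) * v ^ k := by
      rw [Finset.mul_sum]
      refine Finset.sum_congr rfl fun k hk => ?_
      rw [Nat.succ_sub (Nat.lt_succ_iff.mp (Finset.mem_range.mp hk)), pow_succ]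
      ring
    rw [Finset.sum_range_succ, step, Nat.sub_self]
    push_cast
    linear_combination u * ih

theorem D_operator_monomial_identity {K : Type*} [Field K] (u v : K) (huv : u ≠ v) (m : ℕ) :
    u ^ (m + 1) * (u + v) / (u - v) ^ 2 + 3 * v ^ (m + 1) / (v - u)
      - 2 * v ^ (m + 2) / (v - u) ^ 2 + 2 * (m : K) * v ^ (m + 1) / (v - u)
    = ∑ k ∈ Finset.range (m + 1), (2 * (k : K) + 1) * u ^ (m - k) * v ^ k := by
  have h : u - v ≠ 0 := sub_ne_zero.mpr huv
  rw [← mul_right_inj' (pow_ne_zero 2 h), sq_sub_mul_sum_odd_mul_pow, ← neg_sub u v]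
  field_simp
  ring
end

section
/- Let z_0, z_1 ∈ ℂ be nonzero, let m ≥ 0 be an integer, and let ε be a real number with 0 < ε < min(|z_0|, |z_1|). Then (1/(2πi))·∮_{|z|=ε} dz/(z^{2m+3}·(z_0²−z²)·(z−z_1)²) = Σ_{a=0}^{m+1} (2(m+1−a)+1)·z_0^{−(2a+2)}·z_1^{−(2(m+1−a)+2)}, where the integral is over the positively oriented circle of radius ε centered at 0. -/
open Metric Finset

/-- The coefficients of the geometric expansion of `1 / (u - w)` at `w = 0`, with exact
remainder, divided by `w ^ n`. -/
theorem inv_pow_mul_inv_sub_eq_sum {K : Type*} [Field K] {u w : K} (hu : u ≠ 0) (hw : w ≠ 0)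
    (huw : u - w ≠ 0) (n : ℕ) :
    (w ^ n)⁻¹ * (u - w)⁻¹ =
      ∑ a ∈ range n, (u ^ (a + 1))⁻¹ * (w ^ (n - a))⁻¹ + (u ^ n)⁻¹ * (u - w)⁻¹ := by
  induction n with
  | zero => simp
  | succ n ih =>
    have hsum : ∑ a ∈ range n, (u ^ (a + 1))⁻¹ * (w ^ (n + 1 - a))⁻¹ =
        w⁻¹ * ∑ a ∈ range n, (u ^ (a + 1))⁻¹ * (w ^ (n - a))⁻¹ := by
      rw [mul_sum]
      refine sum_congr rfl fun a ha => ?_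
      rw [Nat.sub_add_comm (mem_range.1 ha).le, pow_succ, mul_inv]
      ring
    have hstep : (w ^ (n + 1))⁻¹ * (u - w)⁻¹ = w⁻¹ * ((w ^ n)⁻¹ * (u - w)⁻¹) := by
      rw [pow_succ, mul_inv]
      ring
    rw [sum_range_succ, hsum, hstep, ih, Nat.add_sub_cancel_left, pow_one]
    field_simp
    ring

theorem prod_range_neg_two_sub {R : Type*} [CommRing R] (k : ℕ) :
    ∏ i ∈ range k, (-2 - i : R) = (-1) ^ k * (k + 1).factorial := by
  induction k with
  | zero => simp
  | succ k ih =>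
    rw [prod_range_succ, ih, Nat.factorial_succ (k + 1)]
    push_cast
    ring

/-- The residue at the origin of a pole multiplied by an inverse square. -/
theorem circleIntegral_inv_pow_mul_inv_sub_sq {w : ℂ} {ε : ℝ} (hε : 0 < ε) (hw : ε < ‖w‖)
    (k : ℕ) :
    ∮ z in C(0, ε), (z ^ (k + 1))⁻¹ * ((z - w) ^ 2)⁻¹ =
      2 * Real.pi * Complex.I * ((k + 1) * (w ^ (k + 2))⁻¹) := by
  have hd : DifferentiableOn ℂ (fun z : ℂ => (z - w) ^ (-2 : ℤ)) (closedBall 0 ε) := by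
    intro z hz
    have hzw : z - w ≠ 0 := by
      rintro h
      rw [sub_eq_zero.1 h, mem_closedBall_zero_iff] at hz
      exact absurd hw hz.not_gt
    exact DifferentiableWithinAt.zpow (by fun_prop) (Or.inl hzw)
  have hw0 : w ≠ 0 := norm_pos_iff.1 (hε.trans hw)
  have hderiv : iteratedDeriv k (fun z : ℂ => (z - w) ^ (-2 : ℤ)) 0 =
      (k + 1).factorial * (w ^ (k + 2))⁻¹ := by
    have h := congr_fun (iteratedDeriv_comp_add_const k (fun z : ℂ => z ^ (-2 : ℤ)) (-w)) 0
    simp only [← sub_eq_add_neg] at h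
    rw [h, iteratedDeriv_eq_iterate, iter_deriv_zpow, zero_sub]
    push_cast
    rw [prod_range_neg_two_sub, show (-2 - k : ℤ) = -((k + 2 : ℕ) : ℤ) by push_cast; ring,
      zpow_neg, zpow_natCast, neg_pow w, mul_inv, pow_add (-1 : ℂ)]
    have h1 : ((-1 : ℂ) ^ k) * ((-1) ^ k)⁻¹ = 1 := mul_inv_cancel₀ (by simp)
    linear_combination ((k + 1).factorial * (w ^ (k + 2))⁻¹ : ℂ) * h1
  have h := hd.circleIntegral_one_div_sub_center_pow_smul hε k
  rw [hderiv, Nat.factorial_succ] at h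
  have hk : (k.factorial : ℂ) ≠ 0 := mod_cast k.factorial_ne_zero
  simp only [sub_zero, one_div, smul_eq_mul, zpow_neg, zpow_ofNat] at h
  rw [h]
  push_cast
  field_simp


theorem airy_residue_double_pole (z₀ z₁ : ℂ) (hz₀ : z₀ ≠ 0) (hz₁ : z₁ ≠ 0) (m : ℕ) (ε : ℝ)
    (hε : 0 < ε) (hε₀ : ε < ‖z₀‖) (hε₁ : ε < ‖z₁‖) :
    (1 / (2 * (Real.pi : ℂ) * Complex.I)) *
        (∮ z in C(0, ε), 1 / (z ^ (2 * m + 3) * (z₀ ^ 2 - z ^ 2) * (z - z₁) ^ 2))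
      = ∑ a ∈ Finset.range (m + 2),
          (2 * ((m + 1 - a : ℤ) : ℂ) + 1) * z₀ ^ (-(2 * (a : ℤ) + 2))
            * z₁ ^ (-(2 * ((m : ℤ) + 1 - a) + 2)) := by
  have hsq : ∀ z : ℂ, ‖z‖ ≤ ε → z₀ ^ 2 - z ^ 2 ≠ 0 := by
    intro z hz h
    have h2 : ‖z₀‖ ^ 2 = ‖z‖ ^ 2 := by rw [← norm_pow, ← norm_pow, sub_eq_zero.1 h]
    have := (sq_eq_sq₀ (norm_nonneg _) (norm_nonneg _)).1 h2
    linarith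
  have hsub : ∀ z : ℂ, ‖z‖ ≤ ε → z - z₁ ≠ 0 := by
    intro z hz h
    rw [sub_eq_zero.1 h] at hz
    linarith
  set r : ℂ → ℂ := fun z => ((z₀ ^ 2) ^ (m + 2))⁻¹ * (z * (z₀ ^ 2 - z ^ 2)⁻¹ * ((z - z₁) ^ 2)⁻¹)
    with hr
  have hrd : DifferentiableOn ℂ r (closedBall 0 ε) := by
    intro z hz
    rw [mem_closedBall_zero_iff] at hz
    have h1 := hsq z hz
    have h2 := pow_ne_zero 2 (hsub z hz)
    exact DifferentiableAt.differentiableWithinAt (by fun_prop (disch := assumption))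
  have hr0 : ∮ z in C(0, ε), r z = 0 :=
    (hrd.mono closure_ball_subset_closedBall).diffContOnCl.circleIntegral_eq_zero hε.le
  have hri : CircleIntegrable r 0 ε :=
    (hrd.continuousOn.mono sphere_subset_closedBall).circleIntegrable hε.le
  set g : ℕ → ℂ → ℂ := fun a z => ((z₀ ^ 2) ^ (a + 1))⁻¹ *
    ((z ^ (2 * (m + 1 - a) + 1))⁻¹ * ((z - z₁) ^ 2)⁻¹) with hg
  have hgi : ∀ a ∈ range (m + 2), CircleIntegrable (g a) 0 ε := by
    intro a _
    refine ContinuousOn.circleIntegrable hε.le fun z hz => ?_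
    rw [mem_sphere_zero_iff_norm] at hz
    have h1 : z ^ (2 * (m + 1 - a) + 1) ≠ 0 :=
      pow_ne_zero _ (norm_pos_iff.1 (hz ▸ hε))
    have h2 := pow_ne_zero 2 (hsub z hz.le)
    exact ContinuousAt.continuousWithinAt (by fun_prop (disch := assumption))
  have hsplit : Set.EqOn
      (fun z : ℂ => 1 / (z ^ (2 * m + 3) * (z₀ ^ 2 - z ^ 2) * (z - z₁) ^ 2))
      (fun z => ∑ a ∈ range (m + 2), g a z + r z) (sphere 0 ε) := by
    intro z hz
    rw [mem_sphere_zero_iff_norm] at hz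
    have hz0 : z ≠ 0 := norm_pos_iff.1 (hz ▸ hε)
    have h := inv_pow_mul_inv_sub_eq_sum (pow_ne_zero 2 hz₀) (pow_ne_zero 2 hz0)
      (hsq z hz.le) (m + 2)
    have hgz : ∑ a ∈ range (m + 2), g a z = (z * ((z - z₁) ^ 2)⁻¹) *
        ∑ a ∈ range (m + 2), ((z₀ ^ 2) ^ (a + 1))⁻¹ * ((z ^ 2) ^ (m + 2 - a))⁻¹ := by
      rw [mul_sum]
      refine sum_congr rfl fun a ha => ?_
      have hpow : (z ^ (2 * (m + 1 - a) + 1))⁻¹ = z * ((z ^ 2) ^ (m + 2 - a))⁻¹ := by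
        rw [← pow_mul, show 2 * (m + 2 - a) = 2 * (m + 1 - a) + 1 + 1 by
          have := mem_range.1 ha
          omega, pow_succ z (_ + 1), mul_inv, mul_left_comm, mul_inv_cancel₀ hz0, mul_one]
      simp only [hg, hpow]
      ring
    have hpow : (z ^ (2 * m + 3))⁻¹ = z * ((z ^ 2) ^ (m + 2))⁻¹ := by
      rw [← pow_mul, show 2 * (m + 2) = 2 * m + 3 + 1 by ring, pow_succ z (_ + 3), mul_inv,
        mul_left_comm, mul_inv_cancel₀ hz0, mul_one]
    simp only [hgz, hr, one_div, mul_inv, hpow]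
    linear_combination (z * ((z - z₁) ^ 2)⁻¹) * h
  have hpi := Complex.two_pi_I_ne_zero
  rw [circleIntegral.integral_congr hε.le hsplit,
    circleIntegral.integral_add (CircleIntegrable.fun_sum _ hgi) hri, hr0, add_zero,
    circleIntegral.integral_fun_sum hgi, mul_sum]
  refine sum_congr rfl fun a ha => ?_
  have hle : a ≤ m + 1 := Nat.lt_succ_iff.1 (mem_range.1 ha)
  obtain ⟨b, hb⟩ := Nat.exists_eq_add_of_le hle
  have hba : m + 1 - a = b := by omega
  have hbz : (m + 1 - a : ℤ) = b := by omega
  simp only [hg, circleIntegral.integral_const_mul]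
  rw [circleIntegral_inv_pow_mul_inv_sub_sq hε hε₁, hba, hbz,
    show 2 * (a : ℤ) + 2 = ((2 * (a + 1) : ℕ) : ℤ) by push_cast; ring,
    show 2 * (b : ℤ) + 2 = ((2 * b + 2 : ℕ) : ℤ) by push_cast; ring,
    zpow_neg, zpow_neg, zpow_natCast, zpow_natCast, pow_mul z₀]
  push_cast
  field_simp
end

section
/- Let z_0, z_1, z_2, z_3 ∈ ℂ be nonzero and let ε be a real number with 0 < ε < min(|z_0|, |z_1|, |z_2|, |z_3|). Then (1/(2πi))·∮_{|z|=ε} [1/(z·(z_0²−z²))]·( 1/((z−z_1)²·z²·z_2²·z_3²) + 1/((z−z_2)²·z²·z_1²·z_3²) + 1/((z−z_3)²·z²·z_1²·z_2²) ) dz = (1/(z_0²z_1²z_2²z_3²))·( 3/z_0² + 3/z_1² + 3/z_2² + 3/z_3² ), where the integral is over the positively oriented circle of radius ε centered at 0. -/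
/-- The residue at `0` of `f z / z ^ 3` is the second Taylor coefficient of `f`. -/
theorem circleIntegral_eq_of_expansion {f g : ℂ → ℂ} {ε : ℝ} (hε : 0 < ε) (c₀ c₁ c₂ : ℂ)
    (hg : DifferentiableOn ℂ g (Metric.closedBall 0 ε))
    (hf : ∀ z ∈ Metric.sphere (0 : ℂ) ε,
      f z = c₀ * (z - 0) ^ (-3 : ℤ) + c₁ * (z - 0) ^ (-2 : ℤ) + c₂ * (z - 0)⁻¹ + g z) :
    (∮ z in C(0, ε), f z) = 2 * Real.pi * Complex.I * c₂ := by
  have hne : ∀ z ∈ Metric.sphere (0 : ℂ) ε, z - 0 ≠ 0 := fun z hz => by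
    simpa using ne_zero_of_mem_sphere hε.ne' ⟨z, hz⟩
  have hzpow (n : ℤ) (c : ℂ) : CircleIntegrable (fun z => c * (z - 0) ^ n) 0 ε := by
    refine ContinuousOn.circleIntegrable hε.le (continuousOn_const.mul ?_)
    exact (continuousOn_id.sub continuousOn_const).zpow₀ n fun z hz => Or.inl (hne z hz)
  have hinv : CircleIntegrable (fun z => c₂ * (z - 0)⁻¹) 0 ε := by
    simpa using hzpow (-1) c₂
  have hgi : CircleIntegrable g 0 ε :=
    (hg.continuousOn.mono Metric.sphere_subset_closedBall).circleIntegrable hε.le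
  have hg₀ : (∮ z in C(0, ε), g z) = 0 :=
    Complex.circleIntegral_eq_zero_of_differentiable_on_off_countable hε.le
      Set.countable_empty hg.continuousOn fun z hz =>
        hg.differentiableAt (Metric.closedBall_mem_nhds_of_mem hz.1)
  rw [circleIntegral.integral_congr hε.le hf,
    circleIntegral.integral_add (((hzpow _ _).fun_add (hzpow _ _)).fun_add hinv) hgi,
    circleIntegral.integral_add ((hzpow _ _).fun_add (hzpow _ _)) hinv,
    circleIntegral.integral_add (hzpow _ _) (hzpow _ _), hg₀]
  simp only [circleIntegral.integral_const_mul]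
  rw [circleIntegral.integral_sub_zpow_of_ne (by norm_num),
    circleIntegral.integral_sub_zpow_of_ne (by norm_num),
    circleIntegral.integral_sub_center_inv _ hε.ne']
  ring

theorem ne_of_mem_closedBall_of_lt_norm {a z : ℂ} {ε : ℝ} (ha : ε < ‖a‖)
    (hz : z ∈ Metric.closedBall (0 : ℂ) ε) : z - a ≠ 0 ∧ a ^ 2 - z ^ 2 ≠ 0 := by
  rw [mem_closedBall_zero_iff] at hz
  refine ⟨fun h => ?_, fun h => ?_⟩
  · rw [sub_eq_zero.mp h] at hz
    linarith
  · rcases sq_eq_sq_iff_eq_or_eq_neg.mp (sub_eq_zero.mp h) with h | h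
    · rw [h] at ha
      linarith
    · rw [h, norm_neg] at ha
      linarith

theorem circleIntegral_airy_term {a b : ℂ} {ε : ℝ} (hε : 0 < ε) (ha : ε < ‖a‖) (hb : ε < ‖b‖) :
    (∮ z in C(0, ε), 1 / (z ^ 3 * ((a ^ 2 - z ^ 2) * (z - b) ^ 2)))
      = 2 * Real.pi * Complex.I * (1 / (a ^ 4 * b ^ 2) + 3 / (a ^ 2 * b ^ 4)) := by
  have ha₀ : a ≠ 0 := norm_pos_iff.mp (hε.trans ha)
  have hb₀ : b ≠ 0 := norm_pos_iff.mp (hε.trans hb)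
  have hden : ∀ z ∈ Metric.closedBall (0 : ℂ) ε, (a ^ 2 - z ^ 2) * (z - b) ^ 2 ≠ 0 := fun z hz =>
    mul_ne_zero (ne_of_mem_closedBall_of_lt_norm ha hz).2
      (pow_ne_zero 2 (ne_of_mem_closedBall_of_lt_norm hb hz).1)
  set c₀ : ℂ := 1 / (a ^ 2 * b ^ 2) with hc₀
  set c₁ : ℂ := 2 / (a ^ 2 * b ^ 3) with hc₁
  set c₂ : ℂ := 1 / (a ^ 4 * b ^ 2) + 3 / (a ^ 2 * b ^ 4) with hc₂
  refine circleIntegral_eq_of_expansion hε c₀ c₁ c₂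
    (g := fun z => (-(c₀ * (2 * b) + c₁ * (a ^ 2 - b ^ 2) - c₂ * (2 * a ^ 2 * b))
      - (-c₀ + c₁ * (2 * b) + c₂ * (a ^ 2 - b ^ 2)) * z
      - (-c₁ + c₂ * (2 * b)) * z ^ 2 + c₂ * z ^ 3) / ((a ^ 2 - z ^ 2) * (z - b) ^ 2)) ?_ ?_
  · exact DifferentiableOn.div (by fun_prop) (by fun_prop) hden
  · intro z hz
    have hz₀ : z ≠ 0 := ne_zero_of_mem_sphere hε.ne' ⟨z, hz⟩
    have hd := hden z (Metric.sphere_subset_closedBall hz)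
    have h₀ : c₀ * (a ^ 2 * b ^ 2) = 1 := by rw [hc₀]; field_simp
    have h₁ : c₁ * (a ^ 2 * b ^ 2) = c₀ * (2 * a ^ 2 * b) := by rw [hc₀, hc₁]; field_simp
    have h₂ : c₂ * (a ^ 2 * b ^ 2) = c₁ * (2 * a ^ 2 * b) - c₀ * (a ^ 2 - b ^ 2) := by
      rw [hc₀, hc₁, hc₂]; field_simp; ring
    clear_value c₀ c₁ c₂
    have h3 : (z - 0) ^ (-3 : ℤ) = 1 / z ^ 3 := by rw [sub_zero, zpow_neg, one_div]; rfl
    have h2 : (z - 0) ^ (-2 : ℤ) = 1 / z ^ 2 := by rw [sub_zero, zpow_neg, one_div]; rfl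
    rw [h3, h2, sub_zero]
    have hexp : (a ^ 2 - z ^ 2) * (z - b) ^ 2 = a ^ 2 * b ^ 2 - 2 * a ^ 2 * b * z
      + (a ^ 2 - b ^ 2) * z ^ 2 + 2 * b * z ^ 3 - z ^ 4 := by ring
    rw [hexp] at hd ⊢
    generalize hD : a ^ 2 * b ^ 2 - 2 * a ^ 2 * b * z
      + (a ^ 2 - b ^ 2) * z ^ 2 + 2 * b * z ^ 3 - z ^ 4 = D at hd ⊢
    field_simp
    rw [← hD]
    linear_combination -h₀ - z * h₁ - z ^ 2 * h₂

theorem airy_W04_residue (z₀ z₁ z₂ z₃ : ℂ) (hz₀ : z₀ ≠ 0) (hz₁ : z₁ ≠ 0) (hz₂ : z₂ ≠ 0)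
    (hz₃ : z₃ ≠ 0) (ε : ℝ) (hε : 0 < ε) (hε₀ : ε < ‖z₀‖)
    (hε₁ : ε < ‖z₁‖) (hε₂ : ε < ‖z₂‖) (hε₃ : ε < ‖z₃‖) :
    (1 / (2 * (Real.pi : ℂ) * Complex.I)) *
        (∮ z in C(0, ε), (1 / (z * (z₀ ^ 2 - z ^ 2))) *
          (1 / ((z - z₁) ^ 2 * z ^ 2 * z₂ ^ 2 * z₃ ^ 2)
            + 1 / ((z - z₂) ^ 2 * z ^ 2 * z₁ ^ 2 * z₃ ^ 2)
            + 1 / ((z - z₃) ^ 2 * z ^ 2 * z₁ ^ 2 * z₂ ^ 2)))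
      = (1 / (z₀ ^ 2 * z₁ ^ 2 * z₂ ^ 2 * z₃ ^ 2)) *
          (3 / z₀ ^ 2 + 3 / z₁ ^ 2 + 3 / z₂ ^ 2 + 3 / z₃ ^ 2) := by
  have hint (b c : ℂ) (hb : ε < ‖b‖) : CircleIntegrable
      (fun z => c * (1 / (z ^ 3 * ((z₀ ^ 2 - z ^ 2) * (z - b) ^ 2)))) 0 ε := by
    refine ContinuousOn.circleIntegrable hε.le (continuousOn_const.mul
      (continuousOn_const.div (by fun_prop) fun z hz => ?_))
    have hz' := Metric.sphere_subset_closedBall hz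
    exact mul_ne_zero (pow_ne_zero 3 (ne_zero_of_mem_sphere hε.ne' ⟨z, hz⟩))
      (mul_ne_zero (ne_of_mem_closedBall_of_lt_norm hε₀ hz').2
        (pow_ne_zero 2 (ne_of_mem_closedBall_of_lt_norm hb hz').1))
  have hsplit (z : ℂ) : (1 / (z * (z₀ ^ 2 - z ^ 2))) *
      (1 / ((z - z₁) ^ 2 * z ^ 2 * z₂ ^ 2 * z₃ ^ 2)
        + 1 / ((z - z₂) ^ 2 * z ^ 2 * z₁ ^ 2 * z₃ ^ 2)
        + 1 / ((z - z₃) ^ 2 * z ^ 2 * z₁ ^ 2 * z₂ ^ 2))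
      = 1 / (z₂ ^ 2 * z₃ ^ 2) * (1 / (z ^ 3 * ((z₀ ^ 2 - z ^ 2) * (z - z₁) ^ 2)))
        + 1 / (z₁ ^ 2 * z₃ ^ 2) * (1 / (z ^ 3 * ((z₀ ^ 2 - z ^ 2) * (z - z₂) ^ 2)))
        + 1 / (z₁ ^ 2 * z₂ ^ 2) * (1 / (z ^ 3 * ((z₀ ^ 2 - z ^ 2) * (z - z₃) ^ 2))) := by
    simp only [mul_add, one_div_mul_one_div]
    refine congrArg₂ _ (congrArg₂ _ ?_ ?_) ?_ <;> exact congrArg _ (by ring)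
  simp only [hsplit]
  rw [circleIntegral.integral_add ((hint _ _ hε₁).fun_add (hint _ _ hε₂)) (hint _ _ hε₃),
    circleIntegral.integral_add (hint _ _ hε₁) (hint _ _ hε₂)]
  simp only [circleIntegral.integral_const_mul]
  rw [circleIntegral_airy_term hε hε₀ hε₁, circleIntegral_airy_term hε hε₀ hε₂,
    circleIntegral_airy_term hε hε₀ hε₃]
  have hpi : (Real.pi : ℂ) ≠ 0 := Complex.ofReal_ne_zero.mpr Real.pi_ne_zero
  field_simp [Complex.I_ne_zero]
  ring
end

section
/- Let z_0, z_1 ∈ ℂ be nonzero and let ε be a real number with 0 < ε < min(|z_0|, |z_1|). Then (1/(2πi))·∮_{|z|=ε} [1/(z·(z_0²−z²))]·( 1/(2·z⁴·z_1²) + 1/(8·z⁴·(z−z_1)²) ) dz = 5/(8·z_0²·z_1⁶) + 3/(8·z_0⁴·z_1⁴) + 5/(8·z_0⁶·z_1²), where the integral is over the positively oriented circle of radius ε centered at 0. -/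
/-- If `f z = ∑ k ≤ n, c k * z ^ k + z ^ (n + 1) * g z` on a circle around the origin, where `g` is
holomorphic inside, then the integral of `f z / z ^ (n + 1)` picks out the coefficient `c n`. -/
theorem circleIntegral_div_pow_of_eq_sum_add {R : ℝ} (hR : 0 < R) (n : ℕ) (c : ℕ → ℂ)
    {f g : ℂ → ℂ} (hg : DifferentiableOn ℂ g (Metric.closedBall 0 R))
    (hf : ∀ z ∈ Metric.sphere (0 : ℂ) R,
      f z = ∑ k ∈ Finset.range (n + 1), c k * z ^ k + z ^ (n + 1) * g z) :
    (∮ z in C(0, R), f z / z ^ (n + 1)) = 2 * Real.pi * Complex.I * c n := by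
  have hint (k : ℕ) : CircleIntegrable (fun z : ℂ => c k * (z - 0) ^ ((k : ℤ) - (n + 1))) 0 R := by
    have h : CircleIntegrable (fun z : ℂ => (z - 0) ^ ((k : ℤ) - (n + 1))) 0 R := by
      rw [circleIntegrable_sub_zpow_iff]
      right; right
      simp [abs_of_pos hR, hR.ne]
    exact h.const_smul (a := c k)
  have hgc : DiffContOnCl ℂ g (Metric.ball 0 R) :=
    DifferentiableOn.diffContOnCl (by rwa [closure_ball _ hR.ne'])
  have hgi : CircleIntegrable g 0 R :=
    (hg.continuousOn.mono Metric.sphere_subset_closedBall).circleIntegrable hR.le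
  calc (∮ z in C(0, R), f z / z ^ (n + 1))
      = ∮ z in C(0, R), (∑ k ∈ Finset.range (n + 1),
          c k * (z - 0) ^ ((k : ℤ) - (n + 1)) + g z) := by
        refine circleIntegral.integral_congr hR.le fun z hz => ?_
        have hz0 : z ≠ 0 := ne_zero_of_mem_sphere hR.ne' ⟨z, hz⟩
        rw [hf z hz, add_div, Finset.sum_div, mul_div_cancel_left₀ _ (pow_ne_zero _ hz0)]
        congr 1
        refine Finset.sum_congr rfl fun k _ => ?_
        rw [sub_zero, zpow_sub₀ hz0, mul_div_assoc]
        norm_cast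
    _ = ∑ k ∈ Finset.range (n + 1), ∮ z in C(0, R), c k * (z - 0) ^ ((k : ℤ) - (n + 1)) := by
        rw [circleIntegral.integral_add (CircleIntegrable.fun_sum _ fun k _ => hint k) hgi,
          hgc.circleIntegral_eq_zero hR.le, add_zero,
          circleIntegral.integral_fun_sum fun k _ => hint k]
    _ = ∮ z in C(0, R), c n * (z - 0) ^ ((n : ℤ) - (n + 1)) := by
        refine Finset.sum_eq_single_of_mem n (by simp) fun k _ hkn => ?_
        rw [circleIntegral.integral_const_mul, circleIntegral.integral_sub_zpow_of_ne (by lia),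
          mul_zero]
    _ = 2 * Real.pi * Complex.I * c n := by
        rw [circleIntegral.integral_const_mul]
        simp only [sub_add_cancel_left, zpow_neg_one]
        rw [circleIntegral.integral_sub_center_inv 0 hR.ne', mul_comm]

theorem inv_sq_sub_sq_eq {K : Type*} [Field K] {a z : K} (ha : a ≠ 0) (h : a ^ 2 - z ^ 2 ≠ 0) :
    1 / (a ^ 2 - z ^ 2) =
      1 / a ^ 2 + z ^ 2 / a ^ 4 + z ^ 4 / a ^ 6 + z ^ 6 / (a ^ 6 * (a ^ 2 - z ^ 2)) := by
  field_simp
  ring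

theorem inv_sub_sq_eq {K : Type*} [Field K] {b z : K} (hb : b ≠ 0) (h : z - b ≠ 0) :
    1 / (z - b) ^ 2 =
      1 / b ^ 2 + 2 * z / b ^ 3 + 3 * z ^ 2 / b ^ 4 + 4 * z ^ 3 / b ^ 5 + 5 * z ^ 4 / b ^ 6 +
        z ^ 5 * (6 * b - 5 * z) / (b ^ 6 * (z - b) ^ 2) := by
  field_simp
  ring

theorem airy_W12_residue (z₀ z₁ : ℂ) (hz₀ : z₀ ≠ 0) (hz₁ : z₁ ≠ 0)
    (ε : ℝ) (hε : 0 < ε) (hε₀ : ε < ‖z₀‖) (hε₁ : ε < ‖z₁‖) :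
    (1 / (2 * (Real.pi : ℂ) * Complex.I)) *
        (∮ z in C(0, ε), (1 / (z * (z₀ ^ 2 - z ^ 2))) *
          (1 / (2 * z ^ 4 * z₁ ^ 2) + 1 / (8 * z ^ 4 * (z - z₁) ^ 2)))
      = 5 / (8 * z₀ ^ 2 * z₁ ^ 6) + 3 / (8 * z₀ ^ 4 * z₁ ^ 4) + 5 / (8 * z₀ ^ 6 * z₁ ^ 2) := by
  have hne₀ : ∀ z ∈ Metric.closedBall (0 : ℂ) ε, z₀ ^ 2 - z ^ 2 ≠ 0 := by
    intro z hz h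
    rw [mem_closedBall_zero_iff] at hz
    rcases sq_eq_sq_iff_eq_or_eq_neg.mp (sub_eq_zero.mp h) with rfl | rfl
    · exact absurd hz hε₀.not_ge
    · exact absurd hz (by simpa using hε₀)
  have hne₁ : ∀ z ∈ Metric.closedBall (0 : ℂ) ε, z - z₁ ≠ 0 := by
    intro z hz h
    rw [mem_closedBall_zero_iff, sub_eq_zero.mp h] at hz
    exact absurd hz hε₁.not_ge
  let f : ℂ → ℂ := fun z =>
    1 / (z₀ ^ 2 - z ^ 2) * (1 / (2 * z₁ ^ 2) + 1 / 8 * (1 / (z - z₁) ^ 2))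
  let c : ℕ → ℂ := fun k => match k with
    | 0 => 5 / (8 * z₀ ^ 2 * z₁ ^ 2)
    | 1 => 2 / (8 * z₀ ^ 2 * z₁ ^ 3)
    | 2 => 3 / (8 * z₀ ^ 2 * z₁ ^ 4) + 5 / (8 * z₀ ^ 4 * z₁ ^ 2)
    | 3 => 4 / (8 * z₀ ^ 2 * z₁ ^ 5) + 2 / (8 * z₀ ^ 4 * z₁ ^ 3)
    | _ => 5 / (8 * z₀ ^ 2 * z₁ ^ 6) + 3 / (8 * z₀ ^ 4 * z₁ ^ 4) + 5 / (8 * z₀ ^ 6 * z₁ ^ 2)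
  let g : ℂ → ℂ := fun z =>
    z / (z₀ ^ 6 * (z₀ ^ 2 - z ^ 2)) * (1 / (2 * z₁ ^ 2) + 1 / 8 * (1 / (z - z₁) ^ 2)) +
      (1 / z₀ ^ 2 + z ^ 2 / z₀ ^ 4 + z ^ 4 / z₀ ^ 6) *
        (1 / 8 * ((6 * z₁ - 5 * z) / (z₁ ^ 6 * (z - z₁) ^ 2))) +
      (4 / (8 * z₀ ^ 4 * z₁ ^ 5) + 2 / (8 * z₀ ^ 6 * z₁ ^ 3) +
        z * (5 / (8 * z₀ ^ 4 * z₁ ^ 6) + 3 / (8 * z₀ ^ 6 * z₁ ^ 4)) +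
        z ^ 2 * (4 / (8 * z₀ ^ 6 * z₁ ^ 5)) + z ^ 3 * (5 / (8 * z₀ ^ 6 * z₁ ^ 6)))
  have hg : DifferentiableOn ℂ g (Metric.closedBall 0 ε) := by
    intro z hz
    have h₀ := hne₀ z hz
    have h₁ := hne₁ z hz
    apply DifferentiableAt.differentiableWithinAt
    fun_prop (disch := simp [*])
  have hf : ∀ z ∈ Metric.sphere (0 : ℂ) ε,
      f z = ∑ k ∈ Finset.range (4 + 1), c k * z ^ k + z ^ (4 + 1) * g z := by
    intro z hz
    have h₀ := hne₀ z (Metric.sphere_subset_closedBall hz)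
    have h₁ := hne₁ z (Metric.sphere_subset_closedBall hz)
    simp only [Finset.sum_range_succ, Finset.sum_range_zero, f, c, g]
    generalize hh : 1 / (2 * z₁ ^ 2) + 1 / 8 * (1 / (z - z₁) ^ 2) = H
    rw [inv_sq_sub_sq_eq hz₀ h₀, add_mul]
    nth_rewrite 1 [← hh]
    rw [inv_sub_sq_eq hz₁ h₁]
    ring
  have hcongr : (∮ z in C(0, ε), (1 / (z * (z₀ ^ 2 - z ^ 2))) *
      (1 / (2 * z ^ 4 * z₁ ^ 2) + 1 / (8 * z ^ 4 * (z - z₁) ^ 2))) =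
      ∮ z in C(0, ε), f z / z ^ (4 + 1) := by
    congr 1
    funext z
    simp only [f, one_div, mul_inv]
    ring
  rw [hcongr, circleIntegral_div_pow_of_eq_sum_add hε 4 c hg hf, one_div,
    inv_mul_cancel_left₀ Complex.two_pi_I_ne_zero]
  rfl
end

section
/- Assume the DVV hypothesis stated in the context. Then for all integers g ≥ 0, n ≥ 0 with 2g+n ≥ 3 and all real numbers w_0, w_1, …, w_n: ω_{g,n+1}(w_0,w_1,…,w_n) = (1/2)·w_0·ω_{g−1,n+2}(w_0,w_0,w_1,…,w_n) + (1/2)·w_0·Σ_{g_1+g_2=g, A_1⊔A_2=[n], 2g_1−1+|A_1|>0, 2g_2−1+|A_2|>0} ω_{g_1,|A_1|+1}(w_0,w_{A_1})·ω_{g_2,|A_2|+1}(w_0,w_{A_2}) + Σ_{i=1}^{n} D_{w_0,w_i}[ x ↦ ω_{g,n}(x, w_{[n]∖{i}}) ], where in the last sum D_{w_0,w_i} is applied to the polynomial in x obtained by substituting the numbers w_j (j ∈ [n]∖{i}) into ω_{g,n}. -/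
open Finset

/-- Real value of the double factorial `k‼` of an integer (with `k‼ = 1` for `k ≤ 0`,
in particular `(-1)‼ = 1`). -/
noncomputable def dfac (k : ℤ) : ℝ := (Nat.doubleFactorial k.toNat : ℝ)

/-- The rescaled correlator `⟨τ̃_{a_1} ⋯ τ̃_{a_n}⟩_g` with `τ̃_a = (2a+1)!! τ_a`. -/
noncomputable def ttau (τ : ℤ → (n : ℕ) → (Fin n → ℤ) → ℝ) (g : ℤ) (n : ℕ)
    (a : Fin n → ℤ) : ℝ :=
  (∏ i, dfac (2 * a i + 1)) * τ g n a

/-- The DVV hypothesis: a symmetric family of correlators `⟨τ_{a_1} ⋯ τ_{a_n}⟩_g`,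
vanishing unless `2g-2+n > 0`, all indices are nonnegative and `∑ aᵢ = 3g-3+n`
(in particular vanishing for `g < 0`), satisfying the Dijkgraaf–Verlinde–Verlinde
(Virasoro) recursion relations. -/
structure DVVFamily (τ : ℤ → (n : ℕ) → (Fin n → ℤ) → ℝ) : Prop where
  symm : ∀ (g : ℤ) (n : ℕ) (a : Fin n → ℤ) (σ : Equiv.Perm (Fin n)), τ g n (a ∘ σ) = τ g n a
  vanish : ∀ (g : ℤ) (n : ℕ) (a : Fin n → ℤ),
      ¬((∀ i, 0 ≤ a i) ∧ 0 < 2 * g - 2 + (n : ℤ) ∧ (∑ i, a i) = 3 * g - 3 + n) → τ g n a = 0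
  dvv : ∀ (g : ℤ) (n : ℕ), 0 ≤ g → 3 ≤ 2 * g + (n : ℤ) → ∀ (a₀ : ℤ) (a : Fin n → ℤ),
      0 ≤ a₀ → (∀ i, 0 ≤ a i) →
      ttau τ g (n + 1) (Fin.cons a₀ a) =
        (∑ i, (2 * (a i : ℝ) + 1) * ttau τ g n (Function.update a i (a₀ + a i - 1)))
        + (1 / 2) * ∑ b₁ ∈ Finset.Icc (0 : ℤ) (a₀ - 2),
            (ttau τ (g - 1) (n + 2) (Fin.cons b₁ (Fin.cons (a₀ - 2 - b₁) a))
             + ∑ g₁ ∈ Finset.Icc (0 : ℤ) g, ∑ A ∈ (univ : Finset (Fin n)).powerset,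
                if 0 < 2 * g₁ - 1 + (A.card : ℤ) ∧ 0 < 2 * (g - g₁) - 1 + ((Aᶜ).card : ℤ) then
                  ttau τ g₁ (A.card + 1) (Fin.cons b₁ (fun j => a (A.orderIsoOfFin rfl j).1))
                  * ttau τ (g - g₁) ((Aᶜ).card + 1)
                      (Fin.cons (a₀ - 2 - b₁) (fun j => a ((Aᶜ).orderIsoOfFin rfl j).1))
                else 0)

/-- The `n`-point polynomial function
`ω_{g,n}(w_1,…,w_n) = ∑ ⟨τ_{a_1}⋯τ_{a_n}⟩_g ∏ (2aᵢ+1)!! wᵢ^{aᵢ+1}`,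
written as a finite sum over `0 ≤ aᵢ ≤ 3g-3+n` (the correlators vanish outside this range). -/
noncomputable def omegaF (τ : ℤ → (n : ℕ) → (Fin n → ℤ) → ℝ) (g : ℤ) (n : ℕ)
    (w : Fin n → ℝ) : ℝ :=
  ∑ a : Fin n → Fin ((3 * g + n - 3).toNat + 1),
    τ g n (fun i => ((a i : ℕ) : ℤ))
      * ∏ i, dfac (2 * ((a i : ℕ) : ℤ) + 1) * w i ^ ((a i : ℕ) + 1)

/-- The polynomial (in one variable `x`) `ω_{g,m+1}(x, w_1, …, w_m)`. -/
noncomputable def omegaPoly (τ : ℤ → (n : ℕ) → (Fin n → ℤ) → ℝ) (g : ℤ) (m : ℕ)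
    (w : Fin m → ℝ) : Polynomial ℝ :=
  ∑ a : Fin (m + 1) → Fin ((3 * g + (m + 1) - 3).toNat + 1),
    Polynomial.C (τ g (m + 1) (fun i => ((a i : ℕ) : ℤ))
        * (∏ i, dfac (2 * ((a i : ℕ) : ℤ) + 1))
        * ∏ j : Fin m, w j ^ ((a j.succ : ℕ) + 1))
      * Polynomial.X ^ ((a 0 : ℕ) + 1)

/-- The linear operator `D_{u,v}` on polynomials in `x`, determined by
`D_{u,v} x^m = uv (u^m + 3u^{m-1}v + ⋯ + (2m+1)v^m)`. -/
noncomputable def Dop (u v : ℝ) (p : Polynomial ℝ) : ℝ :=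
  ∑ m ∈ p.support, p.coeff m *
    (u * v * ∑ k ∈ Finset.range (m + 1), (2 * (k : ℝ) + 1) * u ^ (m - k) * v ^ k)

/-- Removing the `i`-th entry from a tuple `(w_1, …, w_n)`. -/
def removeIdx {n : ℕ} (w : Fin n → ℝ) (i : Fin n) (j : Fin (n - 1)) : ℝ :=
  if (j : ℕ) < (i : ℕ) then w ⟨j, by have := j.2; omega⟩
  else w ⟨(j : ℕ) + 1, by have := j.2; omega⟩

lemma ttau_eq_zero {τ : ℤ → (n : ℕ) → (Fin n → ℤ) → ℝ} (h : DVVFamily τ) {g : ℤ} {n : ℕ}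
    {a : Fin n → ℤ}
    (ha : ¬((∀ i, 0 ≤ a i) ∧ 0 < 2 * g - 2 + (n : ℤ) ∧ (∑ i, a i) = 3 * g - 3 + n)) :
    ttau τ g n a = 0 := by
  rw [ttau, h.vanish g n a ha, mul_zero]

lemma ttau_comp_perm {τ : ℤ → (n : ℕ) → (Fin n → ℤ) → ℝ} (h : DVVFamily τ) (g : ℤ) (n : ℕ)
    (a : Fin n → ℤ) (σ : Equiv.Perm (Fin n)) : ttau τ g n (a ∘ σ) = ttau τ g n a := by
  rw [ttau, ttau, h.symm]
  congr 1
  exact Equiv.prod_comp σ (fun i => dfac (2 * a i + 1))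

lemma ttau_insertNth {τ : ℤ → (n : ℕ) → (Fin n → ℤ) → ℝ} (h : DVVFamily τ) (g : ℤ) (n : ℕ)
    (p : Fin (n + 1)) (x : ℤ) (a : Fin n → ℤ) :
    ttau τ g (n + 1) (p.insertNth x a : Fin (n + 1) → ℤ)
      = ttau τ g (n + 1) (Fin.cons x a : Fin (n + 1) → ℤ) := by
  rw [← Fin.insertNth_comp_cycleRange_symm p x a]
  exact (ttau_comp_perm h g (n + 1) _ _).symm

/-- The integer tuple underlying a tuple of indices bounded by `B`. -/
def toIntTuple {n B : ℕ} (a : Fin n → Fin B) : Fin n → ℤ := fun i => ((a i : ℕ) : ℤ)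

/-- The monomial `∏ wᵢ^{aᵢ+1}`. -/
noncomputable def shiftedMonomial {n B : ℕ} (w : Fin n → ℝ) (a : Fin n → Fin B) : ℝ :=
  ∏ i, w i ^ ((a i : ℕ) + 1)

lemma toIntTuple_cons {n B : ℕ} (x : Fin B) (a : Fin n → Fin B) :
    toIntTuple (Fin.cons x a : Fin (n + 1) → Fin B) = Fin.cons ((x : ℕ) : ℤ) (toIntTuple a) := by
  ext i
  refine Fin.cases ?_ (fun j => ?_) i <;> simp [toIntTuple]

lemma toIntTuple_insertNth {n B : ℕ} (p : Fin (n + 1)) (x : Fin B) (a : Fin n → Fin B) :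
    toIntTuple (p.insertNth x a : Fin (n + 1) → Fin B)
      = p.insertNth ((x : ℕ) : ℤ) (toIntTuple a) := by
  ext i
  refine Fin.succAboveCases p ?_ (fun j => ?_) i <;> simp [toIntTuple]

lemma toIntTuple_nonneg {n B : ℕ} (a : Fin n → Fin B) (i : Fin n) : 0 ≤ toIntTuple a i :=
  Int.natCast_nonneg _

lemma shiftedMonomial_cons {n B : ℕ} (w₀ : ℝ) (w : Fin n → ℝ) (x : Fin B) (a : Fin n → Fin B) :
    shiftedMonomial (Fin.cons w₀ w : Fin (n + 1) → ℝ) (Fin.cons x a : Fin (n + 1) → Fin B)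
      = w₀ ^ ((x : ℕ) + 1) * shiftedMonomial w a := by
  simp [shiftedMonomial, Fin.prod_univ_succ]

lemma shiftedMonomial_insertNth {n B : ℕ} (p : Fin (n + 1)) (w : Fin (n + 1) → ℝ) (x : Fin B)
    (a : Fin n → Fin B) :
    shiftedMonomial w (p.insertNth x a : Fin (n + 1) → Fin B)
      = w p ^ ((x : ℕ) + 1) * shiftedMonomial (p.removeNth w) a := by
  simp [shiftedMonomial, Fin.prod_univ_succAbove _ p, Fin.removeNth]

lemma sum_cons_tuple {n B : ℕ} (F : (Fin (n + 1) → Fin B) → ℝ) :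
    ∑ a, F a = ∑ a : Fin n → Fin B, ∑ x : Fin B, F (Fin.cons x a) := by
  rw [← (Fin.consEquiv fun _ => Fin B).sum_comp, Fintype.sum_prod_type_right]
  rfl

lemma sum_insertNth_tuple {n B : ℕ} (p : Fin (n + 1)) (F : (Fin (n + 1) → Fin B) → ℝ) :
    ∑ a, F a = ∑ a : Fin n → Fin B, ∑ x : Fin B, F (p.insertNth x a) := by
  rw [← (Fin.insertNthEquiv (fun _ => Fin B) p).sum_comp, Fintype.sum_prod_type_right]
  rfl

lemma sum_ttau_castLE {τ : ℤ → (n : ℕ) → (Fin n → ℤ) → ℝ} (h : DVVFamily τ) (g : ℤ) (n : ℕ)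
    {N B : ℕ} (hN : 3 * g + n - 3 < N) (hB : N ≤ B) (f : (Fin n → ℤ) → ℝ) :
    ∑ a : Fin n → Fin N, ttau τ g n (toIntTuple a) * f (toIntTuple a)
      = ∑ a : Fin n → Fin B, ttau τ g n (toIntTuple a) * f (toIntTuple a) := by
  refine Fintype.sum_of_injective (fun a i => Fin.castLE hB (a i)) ?_ _ _ ?_ ?_
  · intro a b hab
    funext i
    exact Fin.castLE_injective hB (congrFun hab i)
  · intro a ha
    rw [ttau_eq_zero h, zero_mul]
    rintro ⟨-, -, hs⟩
    refine ha ⟨fun i => ⟨a i, ?_⟩, rfl⟩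
    have := Finset.single_le_sum (f := toIntTuple a) (fun i _ => toIntTuple_nonneg a i)
      (Finset.mem_univ i)
    simp only [toIntTuple] at this hs
    omega
  · intro a
    rfl

lemma omegaF_eq_sum {τ : ℤ → (n : ℕ) → (Fin n → ℤ) → ℝ} (h : DVVFamily τ) (g : ℤ) (n : ℕ)
    (w : Fin n → ℝ) {B : ℕ} (hB : 3 * g + n - 3 < B) (hB0 : 0 < B) :
    omegaF τ g n w
      = ∑ a : Fin n → Fin B, ttau τ g n (toIntTuple a) * shiftedMonomial w a := by
  have key := sum_ttau_castLE h g n (N := (3 * g + n - 3).toNat + 1) (B := B) (by omega) (by omega)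
    (fun z => ∏ i, w i ^ ((z i).toNat + 1))
  refine Eq.trans ?_ key
  refine Finset.sum_congr rfl fun a _ => ?_
  have ha : toIntTuple a = fun i => ((a i : ℕ) : ℤ) := rfl
  simp only [ha, ttau, Finset.prod_mul_distrib, Int.toNat_natCast]
  ring

/-- The value of `D_{u,v}` on the monomial `x^m`. -/
noncomputable def dopMonomial (u v : ℝ) (m : ℕ) : ℝ :=
  u * v * ∑ k ∈ Finset.range (m + 1), (2 * (k : ℝ) + 1) * u ^ (m - k) * v ^ k

lemma Dop_sum_C_mul_X_pow {ι : Type*} (u v : ℝ) (s : Finset ι) (c : ι → ℝ) (e : ι → ℕ) :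
    Dop u v (∑ i ∈ s, Polynomial.C (c i) * Polynomial.X ^ e i)
      = ∑ i ∈ s, c i * dopMonomial u v (e i) := by
  have hD : ∀ p : Polynomial ℝ, Dop u v p = p.sum fun m c => c * dopMonomial u v m :=
    fun _ => rfl
  induction s using Finset.cons_induction with
  | empty => simp [hD]
  | cons i s hi ih =>
    rw [Finset.sum_cons, Finset.sum_cons, hD, Polynomial.sum_add_index _ _ _ (by simp)
      (by intros; ring), ← hD, ← hD, ih, hD, Polynomial.C_mul_X_pow_eq_monomial,
      Polynomial.sum_monomial_index _ _ (by simp)]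

lemma Dop_omegaPoly {τ : ℤ → (n : ℕ) → (Fin n → ℤ) → ℝ} (h : DVVFamily τ) (g : ℤ) (m : ℕ)
    (w : Fin m → ℝ) (u v : ℝ) {B : ℕ} (hB : 3 * g + m - 2 < B) (hB0 : 0 < B) :
    Dop u v (omegaPoly τ g m w)
      = ∑ a : Fin m → Fin B, ∑ x : Fin B,
          ttau τ g (m + 1) (Fin.cons ((x : ℕ) : ℤ) (toIntTuple a) : Fin (m + 1) → ℤ)
            * shiftedMonomial w a * dopMonomial u v (x + 1) := by
  have key := sum_ttau_castLE h g (m + 1) (N := (3 * g + (m + 1) - 3).toNat + 1) (B := B)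
    (by push_cast; omega) (by omega)
    (fun z => (∏ j : Fin m, w j ^ ((z j.succ).toNat + 1)) * dopMonomial u v ((z 0).toNat + 1))
  rw [omegaPoly, Dop_sum_C_mul_X_pow]
  refine Eq.trans ?_ (key.trans ?_)
  · refine Finset.sum_congr rfl fun a _ => ?_
    have ha : toIntTuple a = fun i => ((a i : ℕ) : ℤ) := rfl
    simp only [ha, ttau, Int.toNat_natCast]
    ring
  · rw [sum_cons_tuple]
    refine Finset.sum_congr rfl fun a _ => Finset.sum_congr rfl fun x _ => ?_
    rw [toIntTuple_cons]
    simp [shiftedMonomial, toIntTuple, mul_assoc]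

lemma sum_convolution (B : ℕ) (u : ℝ) (H : ℤ → ℤ → ℝ)
    (hH : ∀ b c : ℕ, B ≤ b + c + 2 → H b c = 0) :
    ∑ x : Fin B, (∑ b ∈ Finset.Icc (0 : ℤ) ((x : ℕ) - 2), H b ((x : ℕ) - 2 - b)) * u ^ ((x : ℕ) + 1)
      = u * ∑ b : Fin B, ∑ c : Fin B,
          H (b : ℕ) (c : ℕ) * (u ^ ((b : ℕ) + 1) * u ^ ((c : ℕ) + 1)) := by
  simp only [Finset.sum_mul, Finset.mul_sum]
  rw [Finset.sum_sigma', ← Finset.sum_product']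
  symm
  rw [← Finset.sum_filter_of_ne (p := fun q : Fin B × Fin B => (q.1 : ℕ) + q.2 + 2 < B)]
  swap
  · intro q _ hq
    by_contra hlt
    exact hq (by rw [hH _ _ (by omega)]; ring)
  refine Finset.sum_bij'
    (i := fun q hq => ⟨⟨(q.1 : ℕ) + q.2 + 2, (Finset.mem_filter.mp hq).2⟩, ((q.1 : ℕ) : ℤ)⟩)
    (j := fun s hs => (⟨s.2.toNat, ?_⟩, ⟨(s.1 : ℕ) - 2 - s.2.toNat, ?_⟩)) ?_ ?_ ?_ ?_ ?_
  · simp only [Finset.mem_sigma, Finset.mem_univ, true_and, Finset.mem_Icc] at hs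
    have := s.1.2
    omega
  · have := s.1.2
    omega
  · intro q hq
    simp
  · intro s hs
    simp only [Finset.mem_sigma, Finset.mem_univ, true_and, Finset.mem_Icc] at hs
    have := s.1.2
    simp
    omega
  · intro q hq
    ext <;> simp
  · rintro ⟨x, b⟩ hs
    simp only [Finset.mem_sigma, Finset.mem_univ, true_and, Finset.mem_Icc] at hs
    have h1 : (b.toNat : ℤ) = b := by omega
    have h2 : b.toNat + ((x : ℕ) - 2 - b.toNat) + 2 = x := by omega
    simp [h1, h2]
  · intro q hq
    have : (((q.1 : ℕ) + (q.2 : ℕ) + 2 : ℕ) : ℤ) - 2 - ((q.1 : ℕ) : ℤ) = ((q.2 : ℕ) : ℤ) := by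
      push_cast; ring
    simp only [this]
    ring

lemma sum_mul_dopMonomial (B : ℕ) (u v : ℝ) (T : ℤ → ℝ) (hneg : T (-1) = 0)
    (hT : ∀ m : ℕ, B ≤ m + 1 → T m = 0) :
    ∑ y : Fin B, ∑ x : Fin B, (2 * ((y : ℕ) : ℝ) + 1) * T (((x : ℕ) : ℤ) + ((y : ℕ) : ℤ) - 1)
        * (u ^ ((x : ℕ) + 1) * v ^ ((y : ℕ) + 1))
      = ∑ m : Fin B, T (m : ℕ) * dopMonomial u v ((m : ℕ) + 1) := by
  simp only [dopMonomial, Finset.mul_sum]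
  rw [← Finset.sum_product', Finset.sum_sigma']
  rw [← Finset.sum_filter_of_ne
    (p := fun q : Fin B × Fin B => 1 ≤ (q.1 : ℕ) + q.2 ∧ (q.1 : ℕ) + q.2 < B)]
  swap
  · intro q _ hq
    by_contra hlt
    apply hq
    have hz : T (((q.2 : ℕ) : ℤ) + ((q.1 : ℕ) : ℤ) - 1) = 0 := by
      rcases Nat.eq_zero_or_pos ((q.1 : ℕ) + q.2) with h0 | h0
      · rw [← hneg]; congr 1; omega
      · rw [← hT ((q.1 : ℕ) + q.2 - 1) (by omega)]; congr 1; omega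
    rw [hz]; ring
  symm
  rw [← Finset.sum_filter_of_ne (p := fun s : (_ : Fin B) × ℕ => (s.1 : ℕ) + 1 < B)]
  swap
  · intro s _ hs
    by_contra hlt
    exact hs (by rw [hT _ (by omega)]; ring)
  refine Finset.sum_bij'
    (i := fun s hs => (⟨s.2, ?_⟩, ⟨(s.1 : ℕ) + 1 - s.2, ?_⟩))
    (j := fun q hq => ⟨⟨(q.1 : ℕ) + q.2 - 1, ?_⟩, (q.1 : ℕ)⟩) ?_ ?_ ?_ ?_ ?_
  · simp at hs
    omega
  · simp at hs
    omega
  · simp at hq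
    omega
  · intro s hs
    simp at hs ⊢
    omega
  · intro q hq
    simp at hq ⊢
    omega
  · rintro ⟨m, k⟩ hs
    simp at hs
    have : k + ((m : ℕ) + 1 - k) - 1 = m := by omega
    simp [this]
  · intro q hq
    simp at hq
    ext <;> simp
    omega
  · rintro ⟨m, k⟩ hs
    simp at hs
    have : (((m : ℕ) + 1 - k : ℕ) : ℤ) + (k : ℤ) - 1 = ((m : ℕ) : ℤ) := by omega
    simp only [this]
    ring

lemma removeIdx_eq_removeNth {n : ℕ} (w : Fin (n + 1) → ℝ) (i : Fin (n + 1)) :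
    (removeIdx w i : Fin n → ℝ) = i.removeNth w := by
  funext j
  simp only [removeIdx, Fin.removeNth, Fin.succAbove, Fin.lt_def, Fin.val_castSucc]
  split_ifs <;> rfl

lemma sum_split_tuple {n B : ℕ} (A : Finset (Fin n))
    (F : (Fin A.card → Fin B) → (Fin (Aᶜ).card → Fin B) → ℝ) :
    ∑ a : Fin n → Fin B, F (fun j => a (A.orderIsoOfFin rfl j).1)
        (fun j => a ((Aᶜ).orderIsoOfFin rfl j).1)
      = ∑ b : Fin A.card → Fin B, ∑ c : Fin (Aᶜ).card → Fin B, F b c := by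
  rw [← Fintype.sum_prod_type']
  exact (((finSumEquivOfFinset (s := A) rfl rfl).symm.arrowCongr (Equiv.refl (Fin B))).trans
    (Equiv.sumArrowEquivProdArrow _ _ _)).sum_comp (fun q => F q.1 q.2)

lemma shiftedMonomial_split {n B : ℕ} (A : Finset (Fin n)) (w : Fin n → ℝ) (a : Fin n → Fin B) :
    shiftedMonomial w a
      = shiftedMonomial (fun j => w (A.orderIsoOfFin rfl j).1)
          (fun j => a (A.orderIsoOfFin rfl j).1)
        * shiftedMonomial (fun j => w ((Aᶜ).orderIsoOfFin rfl j).1)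
          (fun j => a ((Aᶜ).orderIsoOfFin rfl j).1) := by
  simp only [shiftedMonomial]
  rw [← (finSumEquivOfFinset (s := A) rfl rfl).prod_comp, Fintype.prod_sum_type]
  rfl

lemma sum_genus_reduction {τ : ℤ → (n : ℕ) → (Fin n → ℤ) → ℝ} (h : DVVFamily τ) (g : ℤ) (n : ℕ)
    (w₀ : ℝ) (w : Fin n → ℝ) {B : ℕ} (hB : 3 * g + n < B) (hB0 : 0 < B) :
    ∑ a : Fin n → Fin B, ∑ x : Fin B,
        (∑ b ∈ Finset.Icc (0 : ℤ) ((x : ℕ) - 2),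
          ttau τ (g - 1) (n + 2) (Fin.cons b (Fin.cons ((x : ℕ) - 2 - b) (toIntTuple a))))
        * (w₀ ^ ((x : ℕ) + 1) * shiftedMonomial w a)
      = w₀ * omegaF τ (g - 1) (n + 2) (Fin.cons w₀ (Fin.cons w₀ w)) := by
  rw [omegaF_eq_sum h (g - 1) (n + 2) _ (B := B) (by push_cast; omega) hB0, sum_cons_tuple,
    sum_cons_tuple, Finset.mul_sum]
  refine Finset.sum_congr rfl fun a _ => ?_
  have key := sum_convolution B w₀
    (fun b c => ttau τ (g - 1) (n + 2) (Fin.cons b (Fin.cons c (toIntTuple a)))) ?_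
  · simp only [← mul_assoc]
    rw [← Finset.sum_mul, key, Finset.sum_comm, mul_assoc, Finset.sum_mul]
    congr 1
    refine Finset.sum_congr rfl fun b _ => ?_
    rw [Finset.sum_mul]
    refine Finset.sum_congr rfl fun c _ => ?_
    simp only [toIntTuple_cons, shiftedMonomial_cons]
    ring
  · intro b c hbc
    apply ttau_eq_zero h
    rintro ⟨-, -, hs⟩
    have := Finset.sum_nonneg fun i (_ : i ∈ Finset.univ) => toIntTuple_nonneg a i
    simp only [Fin.sum_univ_succ, Fin.cons_zero, Fin.cons_succ] at hs
    push_cast at hs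
    omega

lemma sum_splitting {τ : ℤ → (n : ℕ) → (Fin n → ℤ) → ℝ} (h : DVVFamily τ) (g₁ g₂ : ℤ) (n : ℕ)
    (A : Finset (Fin n)) (w₀ : ℝ) (w : Fin n → ℝ) {B : ℕ} (hg₁ : 0 ≤ g₁) (hg₂ : 0 ≤ g₂)
    (hB : 3 * (g₁ + g₂) + n < B) :
    ∑ a : Fin n → Fin B, ∑ x : Fin B,
        (∑ b ∈ Finset.Icc (0 : ℤ) ((x : ℕ) - 2),
          ttau τ g₁ (A.card + 1)
              (Fin.cons b (fun j => toIntTuple a (A.orderIsoOfFin rfl j).1))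
            * ttau τ g₂ ((Aᶜ).card + 1)
              (Fin.cons ((x : ℕ) - 2 - b) (fun j => toIntTuple a ((Aᶜ).orderIsoOfFin rfl j).1)))
        * (w₀ ^ ((x : ℕ) + 1) * shiftedMonomial w a)
      = w₀ * (omegaF τ g₁ (A.card + 1) (Fin.cons w₀ (fun j => w (A.orderIsoOfFin rfl j).1))
          * omegaF τ g₂ ((Aᶜ).card + 1)
              (Fin.cons w₀ (fun j => w ((Aᶜ).orderIsoOfFin rfl j).1))) := by
  have hcard : A.card + (Aᶜ).card = n := by simp [Finset.card_add_card_compl]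
  rw [omegaF_eq_sum h g₁ (A.card + 1) _ (B := B) (by push_cast; omega) (by omega),
    omegaF_eq_sum h g₂ ((Aᶜ).card + 1) _ (B := B) (by push_cast; omega) (by omega),
    sum_cons_tuple, sum_cons_tuple, Finset.sum_mul_sum, Finset.mul_sum]
  simp only [Finset.mul_sum (a := w₀)]
  rw [← sum_split_tuple A]
  refine Finset.sum_congr rfl fun a _ => ?_
  have key := sum_convolution B w₀ (fun b c => ttau τ g₁ (A.card + 1)
              (Fin.cons b (fun j => toIntTuple a (A.orderIsoOfFin rfl j).1))
            * ttau τ g₂ ((Aᶜ).card + 1)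
              (Fin.cons c (fun j => toIntTuple a ((Aᶜ).orderIsoOfFin rfl j).1))) ?_
  · simp only [← mul_assoc]
    rw [← Finset.sum_mul, key, mul_assoc, mul_assoc, Finset.sum_mul, Finset.sum_mul_sum]
    congr 1
    refine Finset.sum_congr rfl fun b _ => ?_
    rw [Finset.sum_mul]
    refine Finset.sum_congr rfl fun c _ => ?_
    simp only [toIntTuple_cons, shiftedMonomial_cons]
    rw [shiftedMonomial_split A]
    have hcomp : ∀ {m : ℕ} (f : Fin m → Fin n),
        (toIntTuple fun j => a (f j)) = fun j => toIntTuple a (f j) := fun _ => rfl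
    rw [hcomp fun j => (A.orderIsoOfFin rfl j).1, hcomp fun j => ((Aᶜ).orderIsoOfFin rfl j).1]
    ring
  · intro b c hbc
    by_contra hne
    have h₁ := not_not.mp (mt (ttau_eq_zero h) (left_ne_zero_of_mul hne))
    have h₂ := not_not.mp (mt (ttau_eq_zero h) (right_ne_zero_of_mul hne))
    have hs₁ := h₁.2.2
    have hs₂ := h₂.2.2
    have p₁ := Finset.sum_nonneg fun j (_ : j ∈ Finset.univ) =>
      toIntTuple_nonneg a (A.orderIsoOfFin rfl j).1
    have p₂ := Finset.sum_nonneg fun j (_ : j ∈ Finset.univ) =>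
      toIntTuple_nonneg a ((Aᶜ).orderIsoOfFin rfl j).1
    simp only [Fin.sum_univ_succ, Fin.cons_zero, Fin.cons_succ] at hs₁ hs₂
    push_cast at hs₁ hs₂
    omega

lemma sum_merging {τ : ℤ → (n : ℕ) → (Fin n → ℤ) → ℝ} (h : DVVFamily τ) (g : ℤ) (n : ℕ)
    (w₀ : ℝ) (w : Fin n → ℝ) (i : Fin n) {B : ℕ} (hB : 3 * g + n < B) (hB0 : 0 < B) :
    ∑ a : Fin n → Fin B, ∑ x : Fin B,
        ((2 * (toIntTuple a i : ℝ) + 1)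
          * ttau τ g n (Function.update (toIntTuple a) i ((x : ℕ) + toIntTuple a i - 1)))
        * (w₀ ^ ((x : ℕ) + 1) * shiftedMonomial w a)
      = Dop w₀ (w i) (omegaPoly τ g (n - 1) (removeIdx w i)) := by
  obtain _ | n := n
  · exact i.elim0
  have hrem : (removeIdx w i : Fin (n + 1 - 1) → ℝ) = i.removeNth w := removeIdx_eq_removeNth w i
  rw [hrem]
  change _ = Dop w₀ (w i) (omegaPoly τ g n (i.removeNth w))
  rw [Dop_omegaPoly h g n _ _ _ (B := B) (by push_cast at hB; omega) hB0, sum_insertNth_tuple i]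
  refine Finset.sum_congr rfl fun a _ => ?_
  have key := sum_mul_dopMonomial B w₀ (w i)
    (fun m => ttau τ g (n + 1) (Fin.cons m (toIntTuple a))) ?_ ?_
  · simp only [mul_right_comm _ (shiftedMonomial _ _)]
    rw [← Finset.sum_mul, ← key, Finset.sum_mul]
    refine Finset.sum_congr rfl fun y _ => ?_
    rw [Finset.sum_mul]
    refine Finset.sum_congr rfl fun x _ => ?_
    rw [toIntTuple_insertNth, shiftedMonomial_insertNth, Fin.update_insertNth, ttau_insertNth h]
    simp only [Fin.insertNth_apply_same, Int.cast_natCast]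
    ring
  · apply ttau_eq_zero h
    rintro ⟨hpos, -⟩
    have := hpos 0
    simp at this
  · intro m hm
    apply ttau_eq_zero h
    rintro ⟨-, -, hs⟩
    have := Finset.sum_nonneg fun i (_ : i ∈ Finset.univ) => toIntTuple_nonneg a i
    simp only [Fin.sum_univ_succ, Fin.cons_zero, Fin.cons_succ] at hs this
    push_cast at hs hB
    omega

lemma sum_sum_mul_comm {α β γ κ : Type*} (S : Finset α) (T : Finset β) (U : β → Finset γ)
    (Q : Finset κ) (F : κ → α → β → γ → ℝ) (W : α → β → ℝ) :
    ∑ a ∈ S, ∑ x ∈ T, (∑ b ∈ U x, ∑ q ∈ Q, F q a x b) * W a x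
      = ∑ q ∈ Q, ∑ a ∈ S, ∑ x ∈ T, (∑ b ∈ U x, F q a x b) * W a x := by
  rw [Finset.sum_comm (s := Q)]
  refine Finset.sum_congr rfl fun a _ => ?_
  rw [Finset.sum_comm (s := Q)]
  refine Finset.sum_congr rfl fun x _ => ?_
  rw [← Finset.sum_mul, Finset.sum_comm]

/-- The Eynard–Orantin recursion for the Airy curve, in the polynomial form
(Theorem 3.2 of the paper): for `2g+n ≥ 3`,
`ω_{g,n+1}(w_0,…,w_n) = ½w_0 ω_{g-1,n+2}(w_0,w_0,w_{[n]})
 + ½w_0 Σˢ ω_{g_1,|A_1|+1}(w_0,w_{A_1}) ω_{g_2,|A_2|+1}(w_0,w_{A_2})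
 + Σᵢ D_{w_0,w_i} ω_{g,n}(x, w_{[n]∖{i}})`. -/
theorem omega_recursion (τ : ℤ → (n : ℕ) → (Fin n → ℤ) → ℝ) (h : DVVFamily τ)
    (g n : ℕ) (h3 : 3 ≤ 2 * g + n) (w₀ : ℝ) (w : Fin n → ℝ) :
    omegaF τ g (n + 1) (Fin.cons w₀ w) =
      (1 / 2) * w₀ * omegaF τ ((g : ℤ) - 1) (n + 2) (Fin.cons w₀ (Fin.cons w₀ w))
      + (1 / 2) * w₀ *
          ∑ g₁ ∈ Finset.Icc (0 : ℤ) (g : ℤ), ∑ A ∈ (Finset.univ : Finset (Fin n)).powerset,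
            (if 0 < 2 * g₁ - 1 + (A.card : ℤ) ∧
                0 < 2 * ((g : ℤ) - g₁) - 1 + ((Aᶜ).card : ℤ) then
              omegaF τ g₁ (A.card + 1) (Fin.cons w₀ (fun j => w (A.orderIsoOfFin rfl j).1))
              * omegaF τ ((g : ℤ) - g₁) ((Aᶜ).card + 1)
                  (Fin.cons w₀ (fun j => w ((Aᶜ).orderIsoOfFin rfl j).1))
            else 0)
      + ∑ i : Fin n, Dop w₀ (w i) (omegaPoly τ g (n - 1) (removeIdx w i)) := by
  set B : ℕ := 3 * g + n + 1 with hB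
  have hB' : 3 * (g : ℤ) + n < B := by omega
  rw [omegaF_eq_sum h g (n + 1) _ (B := B) (by push_cast; omega) (by omega), sum_cons_tuple]
  simp only [toIntTuple_cons, shiftedMonomial_cons]
  have hmerge : ∑ i : Fin n, Dop w₀ (w i) (omegaPoly τ g (n - 1) (removeIdx w i))
      = ∑ a : Fin n → Fin B, ∑ x : Fin B,
        (∑ i, (2 * (toIntTuple a i : ℝ) + 1)
          * ttau τ g n (Function.update (toIntTuple a) i ((x : ℕ) + toIntTuple a i - 1)))
        * (w₀ ^ ((x : ℕ) + 1) * shiftedMonomial w a) := by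
    have key := sum_sum_mul_comm (Finset.univ : Finset (Fin n → Fin B))
      (Finset.univ : Finset (Fin B)) (fun _ => ({()} : Finset Unit)) (Finset.univ : Finset (Fin n))
      (fun i a x _ => (2 * (toIntTuple a i : ℝ) + 1)
          * ttau τ g n (Function.update (toIntTuple a) i ((x : ℕ) + toIntTuple a i - 1)))
      (fun a x => w₀ ^ ((x : ℕ) + 1) * shiftedMonomial w a)
    simp only [Finset.sum_singleton] at key
    rw [key]
    exact Finset.sum_congr rfl fun i _ => (sum_merging h g n w₀ w i hB' (by omega)).symm
  have hsplit : w₀ * ∑ g₁ ∈ Finset.Icc (0 : ℤ) (g : ℤ),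
      ∑ A ∈ (Finset.univ : Finset (Fin n)).powerset,
        (if 0 < 2 * g₁ - 1 + (A.card : ℤ) ∧ 0 < 2 * ((g : ℤ) - g₁) - 1 + ((Aᶜ).card : ℤ) then
          omegaF τ g₁ (A.card + 1) (Fin.cons w₀ (fun j => w (A.orderIsoOfFin rfl j).1))
          * omegaF τ ((g : ℤ) - g₁) ((Aᶜ).card + 1)
              (Fin.cons w₀ (fun j => w ((Aᶜ).orderIsoOfFin rfl j).1))
        else 0)
      = ∑ a : Fin n → Fin B, ∑ x : Fin B,
        (∑ b ∈ Finset.Icc (0 : ℤ) ((x : ℕ) - 2), ∑ g₁ ∈ Finset.Icc (0 : ℤ) (g : ℤ),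
          ∑ A ∈ (Finset.univ : Finset (Fin n)).powerset,
            if 0 < 2 * g₁ - 1 + (A.card : ℤ) ∧ 0 < 2 * ((g : ℤ) - g₁) - 1 + ((Aᶜ).card : ℤ) then
              ttau τ g₁ (A.card + 1)
                (Fin.cons b (fun j => toIntTuple a (A.orderIsoOfFin rfl j).1))
              * ttau τ (g - g₁) ((Aᶜ).card + 1)
                (Fin.cons ((x : ℕ) - 2 - b) (fun j => toIntTuple a ((Aᶜ).orderIsoOfFin rfl j).1))
            else 0)
        * (w₀ ^ ((x : ℕ) + 1) * shiftedMonomial w a) := by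
    rw [sum_sum_mul_comm, Finset.mul_sum]
    refine Finset.sum_congr rfl fun g₁ hg₁ => ?_
    rw [sum_sum_mul_comm, Finset.mul_sum]
    refine Finset.sum_congr rfl fun A _ => ?_
    rw [Finset.mem_Icc] at hg₁
    split_ifs
    · exact (sum_splitting h g₁ (g - g₁) n A w₀ w hg₁.1 (by omega) (by omega)).symm
    · simp
  rw [mul_assoc, mul_assoc (1 / 2) w₀, hsplit, hmerge,
    ← sum_genus_reduction h g n w₀ w hB' (by omega)]
  rw [Finset.mul_sum, Finset.mul_sum, ← Finset.sum_add_distrib, ← Finset.sum_add_distrib]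
  refine Finset.sum_congr rfl fun a _ => ?_
  rw [Finset.mul_sum, Finset.mul_sum, ← Finset.sum_add_distrib, ← Finset.sum_add_distrib]
  refine Finset.sum_congr rfl fun x _ => ?_
  rw [h.dvv g n (by omega) (by omega) _ (toIntTuple a) (by omega) (toIntTuple_nonneg a),
    Finset.sum_add_distrib]
  ring
end

section
/- Assume the DVV hypothesis stated in the context, together with the base values ⟨τ_0τ_0τ_0⟩_0 = 1 and ⟨τ_1⟩_1 = 1/24. Then for all integers g ≥ 0, n ≥ 0 with 2g−1+n > 0, all nonzero complex numbers z_0, z_1, …, z_n, and every real ε with 0 < ε < min(|z_0|,…,|z_n|): tW_{g,n+1}(z_0,z_1,…,z_n) = (1/(2πi))·∮_{|z|=ε} [1/(2z·(z_0²−z²))]·( tW_{g−1,n+2}(z,−z,z_1,…,z_n) + Σ_{g_1+g_2=g, A_1⊔A_2=[n]} tW_{g_1,|A_1|+1}(z,z_{A_1})·tW_{g_2,|A_2|+1}(−z,z_{A_2}) ) dz, where the splitting sum is over all g_1, g_2 ≥ 0 and all ordered decompositions A_1⊔A_2 = [n] = {1,…,n}, and the integral is over the positively oriented circle of radius ε centered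 at 0. -/
open Finset

/-- The generating functions `tW_{g,n}(z_1,…,z_n) = ∑ ⟨τ_{a_1}⋯τ_{a_n}⟩_g ∏ (2aᵢ+1)!!/zᵢ^{2aᵢ+2}`
for stable `(g,n)`, with the conventions `tW_{0,2}(x,y) = 1/(x-y)²`, `tW_{0,1} = 0`
and `tW_{g,n} = 0` for `g < 0` (and for the remaining unstable cases). -/
noncomputable def tW (τ : ℤ → (n : ℕ) → (Fin n → ℤ) → ℝ) (g : ℤ) (n : ℕ)
    (z : Fin n → ℂ) : ℂ :=
  if h : g = 0 ∧ n = 2 then 1 / (z ⟨0, by omega⟩ - z ⟨1, by omega⟩) ^ 2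
  else if 0 ≤ g ∧ 0 < 2 * g - 2 + (n : ℤ) then
    ∑ a : Fin n → Fin ((3 * g + n - 3).toNat + 1),
      ((τ g n (fun i => ((a i : ℕ) : ℤ)) : ℝ) : ℂ)
        * ∏ i, ((dfac (2 * ((a i : ℕ) : ℤ) + 1) : ℝ) : ℂ) / z i ^ (2 * (a i : ℕ) + 2)
  else 0


namespace AiryRecursion

open Metric Filter Topology

/-- `F` is given on the circle of radius `ε` by the absolutely convergent even power series with
coefficients `c`. -/
def EvenSeriesOn (ε : ℝ) (F : ℂ → ℂ) (c : ℕ → ℂ) : Prop :=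
  Summable (fun k => ‖c k‖ * ε ^ (2 * k)) ∧
    ∀ z ∈ sphere (0 : ℂ) ε, HasSum (fun k => c k * z ^ (2 * k)) (F z)

theorem ne_zero_of_mem_sphere {ε : ℝ} (hε : 0 < ε) {z : ℂ} (hz : z ∈ sphere (0 : ℂ) ε) :
    z ≠ 0 := by
  rintro rfl
  simp at hz
  exact hε.ne hz

theorem EvenSeriesOn.mul {ε : ℝ} (hε : 0 < ε) {F G : ℂ → ℂ} {c d : ℕ → ℂ}
    (hF : EvenSeriesOn ε F c) (hG : EvenSeriesOn ε G d) :
    EvenSeriesOn ε (fun z => F z * G z)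
      (fun m => ∑ k ∈ antidiagonal m, c k.1 * d k.2) := by
  have key : ∀ (z : ℂ) (m : ℕ),
      ∑ k ∈ antidiagonal m, (c k.1 * z ^ (2 * k.1)) * (d k.2 * z ^ (2 * k.2)) =
        (∑ k ∈ antidiagonal m, c k.1 * d k.2) * z ^ (2 * m) := by
    intro z m
    rw [sum_mul]
    refine sum_congr rfl fun k hk => ?_
    rw [← mem_antidiagonal.1 hk]
    ring
  have norms : ∀ (a : ℕ → ℂ) (z : ℂ), ‖z‖ = ε →
      (fun k => ‖a k * z ^ (2 * k)‖) = fun k => ‖a k‖ * ε ^ (2 * k) := by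
    intro a z hz
    ext k
    rw [norm_mul, norm_pow, hz]
  have sumF : ∀ z : ℂ, ‖z‖ = ε → Summable fun k => ‖c k * z ^ (2 * k)‖ := fun z hz => by
    rw [norms c z hz]; exact hF.1
  have sumG : ∀ z : ℂ, ‖z‖ = ε → Summable fun k => ‖d k * z ^ (2 * k)‖ := fun z hz => by
    rw [norms d z hz]; exact hG.1
  have hnorm : ∀ z : ℂ, ‖z‖ = ε →
      Summable fun m => ‖(∑ k ∈ antidiagonal m, c k.1 * d k.2) * z ^ (2 * m)‖ := fun z hz => by
    simpa only [key] using summable_norm_sum_mul_antidiagonal_of_summable_norm (sumF z hz)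
      (sumG z hz)
  refine ⟨?_, fun z hz => ?_⟩
  · have hz : ‖(ε : ℂ)‖ = ε := by simp [abs_of_pos hε]
    rw [← norms _ _ hz]
    exact hnorm _ hz
  · have hz' : ‖z‖ = ε := by simpa using hz
    have := tsum_mul_tsum_eq_tsum_sum_antidiagonal_of_summable_norm (sumF z hz') (sumG z hz')
    rw [(hF.2 z hz).tsum_eq, (hG.2 z hz).tsum_eq] at this
    simp only [key] at this
    simp only [this]
    exact (hnorm z hz').of_norm.hasSum

/-- Extraction of a coefficient of an even power series by a contour integral. -/
theorem EvenSeriesOn.circleIntegral {ε : ℝ} (hε : 0 < ε) {F : ℂ → ℂ} {c : ℕ → ℂ}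
    (hF : EvenSeriesOn ε F c) (m : ℕ) :
    CircleIntegrable (fun z => F z * (z ^ (2 * m + 1))⁻¹) 0 ε ∧
      (∮ z in C(0, ε), F z * (z ^ (2 * m + 1))⁻¹) = 2 * Real.pi * Complex.I * c m := by
  set f : ℕ → ℂ → ℂ := fun k z => c k * (z ^ (2 * k) * (z ^ (2 * m + 1))⁻¹)
  have hbound : ∀ k, ∀ z ∈ sphere (0 : ℂ) ε,
      ‖f k z‖ ≤ ‖c k‖ * ε ^ (2 * k) * (ε ^ (2 * m + 1))⁻¹ := by
    intro k z hz
    have hz' : ‖z‖ = ε := by simpa using hz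
    simp [f, hz', mul_assoc]
  have hcont : ∀ k, ContinuousOn (f k) (sphere (0 : ℂ) ε) := by
    intro k
    have hpow : Continuous fun z : ℂ => z ^ (2 * k) := by fun_prop
    refine continuousOn_const.mul (hpow.continuousOn.mul
      (ContinuousOn.inv₀ (by fun_prop) fun z hz => pow_ne_zero _ (ne_zero_of_mem_sphere hε hz)))
  have hunif := tendstoUniformlyOn_tsum_nat (hF.1.mul_right (ε ^ (2 * m + 1))⁻¹) hbound
  have htsum : ∀ z ∈ sphere (0 : ℂ) ε, ∑' k, f k z = F z * (z ^ (2 * m + 1))⁻¹ := by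
    intro z hz
    have := ((hF.2 z hz).mul_right (z ^ (2 * m + 1))⁻¹).tsum_eq
    simpa only [f, mul_assoc] using this
  have hsum_cont : ∀ N, ContinuousOn (fun z => ∑ k ∈ range N, f k z) (sphere (0 : ℂ) ε) :=
    fun N => continuousOn_finsetSum _ fun k _ => hcont k
  have hlim_cont : ContinuousOn (fun z => F z * (z ^ (2 * m + 1))⁻¹) (sphere (0 : ℂ) ε) :=
    (hunif.continuousOn (Frequently.of_forall hsum_cont)).congr fun z hz => (htsum z hz).symm
  refine ⟨hlim_cont.circleIntegrable hε.le, ?_⟩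
  have hintegral : ∀ k, (∮ z in C(0, ε), f k z) =
      if k = m then 2 * Real.pi * Complex.I * c m else 0 := by
    intro k
    have hzpow : (∮ z in C(0, ε), f k z) =
        c k * ∮ z in C(0, ε), (z - 0) ^ (2 * (k : ℤ) - 2 * m - 1) := by
      rw [← circleIntegral.integral_const_mul]
      refine circleIntegral.integral_congr hε.le fun z hz => ?_
      have hz0 := ne_zero_of_mem_sphere hε hz
      simp only [f, sub_zero]
      rw [sub_sub, zpow_sub₀ hz0, div_eq_mul_inv]
      norm_cast
    rw [hzpow]
    split_ifs with hk
    · subst hk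
      simp only [sub_self, zero_sub, zpow_neg_one]
      rw [circleIntegral.integral_sub_center_inv _ hε.ne']
      ring
    · rw [circleIntegral.integral_sub_zpow_of_ne (by omega), mul_zero]
  have hlim := hunif.tendsto_circleIntegral_of_continuousOn hε.le (Eventually.of_forall hsum_cont)
  rw [circleIntegral.integral_congr hε.le htsum] at hlim
  refine tendsto_nhds_unique hlim (tendsto_const_nhds.congr' ?_)
  filter_upwards [eventually_gt_atTop m] with N hN
  rw [circleIntegral.integral_fun_sum fun k _ => (hcont k).circleIntegrable hε.le]
  simp [hintegral, hN]

theorem norm_div_sq_lt_one {ε : ℝ} (hε : 0 < ε) {w z : ℂ} (hw : ε < ‖w‖) (hz : ‖z‖ = ε) :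
    ‖z ^ 2 / w ^ 2‖ < 1 := by
  rw [norm_div, norm_pow, norm_pow, hz, div_lt_one (pow_pos (hε.trans hw) 2)]
  gcongr

theorem evenSeriesOn_of_hasSum {ε : ℝ} (hε : 0 < ε) {F : ℂ → ℂ} {c : ℕ → ℂ}
    (h : ∀ z : ℂ, ‖z‖ = ε → HasSum (fun k => c k * z ^ (2 * k)) (F z)) : EvenSeriesOn ε F c := by
  refine ⟨?_, fun z hz => h z (by simpa using hz)⟩
  have hz : ‖(ε : ℂ)‖ = ε := by simp [abs_of_pos hε]
  have := (h _ hz).summable.norm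
  simpa [abs_of_pos hε] using this

theorem evenSeriesOn_kernel {ε : ℝ} (hε : 0 < ε) {w : ℂ} (hw : ε < ‖w‖) :
    EvenSeriesOn ε (fun z => 1 / (w ^ 2 - z ^ 2)) (fun k => (w ^ (2 * k + 2))⁻¹) := by
  refine evenSeriesOn_of_hasSum hε fun z hz => ?_
  have hw0 : w ≠ 0 := norm_pos_iff.1 (hε.trans hw)
  have hlt := norm_div_sq_lt_one hε hw hz
  have hne : w ^ 2 - z ^ 2 ≠ 0 := by
    intro h0
    rw [← sub_eq_zero.1 h0, div_self (pow_ne_zero _ hw0)] at hlt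
    simp at hlt
  have hne' : 1 - z ^ 2 / w ^ 2 ≠ 0 := by
    rw [one_sub_div (pow_ne_zero _ hw0)]
    exact div_ne_zero hne (pow_ne_zero _ hw0)
  convert! (hasSum_geometric_of_norm_lt_one hlt).mul_left (w ^ 2)⁻¹ using 1
  · ext k
    rw [div_pow, ← pow_mul, ← pow_mul, pow_add, mul_inv]
    ring
  · rw [one_sub_div (pow_ne_zero _ hw0)]
    field_simp

theorem evenSeriesOn_bergman {ε : ℝ} (hε : 0 < ε) {w : ℂ} (hw : ε < ‖w‖) :
    EvenSeriesOn ε (fun z => 1 / (z - w) ^ 2 + 1 / (-z - w) ^ 2)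
      (fun k => 2 * ((2 * k + 1) * (w ^ (2 * k + 2))⁻¹)) := by
  refine evenSeriesOn_of_hasSum hε fun z hz => ?_
  have hw0 : w ≠ 0 := norm_pos_iff.1 (hε.trans hw)
  have hlt := norm_div_sq_lt_one hε hw hz
  have h1 : z - w ≠ 0 := by
    intro h0
    rw [sub_eq_zero.1 h0] at hz
    exact hw.ne' hz
  have h2 : -z - w ≠ 0 := by
    intro h0
    rw [← sub_eq_zero.1 h0, norm_neg] at hw
    exact hw.ne' hz
  have hne : w ^ 2 - z ^ 2 ≠ 0 := by
    rw [show w ^ 2 - z ^ 2 = (z - w) * (-z - w) by ring]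
    exact mul_ne_zero h1 h2
  convert! (((hasSum_coe_mul_geometric_of_norm_lt_one hlt).mul_left 2).add
    (hasSum_geometric_of_norm_lt_one hlt)).mul_left (2 * (w ^ 2)⁻¹) using 1
  · ext k
    rw [div_pow, ← pow_mul, ← pow_mul, pow_add, mul_inv]
    ring
  · rw [one_sub_div (pow_ne_zero _ hw0)]
    have h3 : z + w ≠ 0 := by
      intro h0; apply h2; linear_combination -h0
    field_simp
    rw [show -z - w = -(z + w) by ring, show w ^ 2 - z ^ 2 = -((z - w) * (z + w)) by ring] at *
    field_simp
    ring

/-- The residue functional of the recursion: the contour integral of `f` against the recursion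
kernel exists and has value `v`. -/
def HasKernelResidue (ε : ℝ) (z₀ : ℂ) (f : ℂ → ℂ) (v : ℂ) : Prop :=
  CircleIntegrable (fun z => 1 / (2 * z * (z₀ ^ 2 - z ^ 2)) * f z) 0 ε ∧
    1 / (2 * (Real.pi : ℂ) * Complex.I) *
      (∮ z in C(0, ε), 1 / (2 * z * (z₀ ^ 2 - z ^ 2)) * f z) = v

theorem HasKernelResidue.add {ε : ℝ} {z₀ : ℂ} {f f' : ℂ → ℂ} {v v' : ℂ}
    (h : HasKernelResidue ε z₀ f v) (h' : HasKernelResidue ε z₀ f' v') :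
    HasKernelResidue ε z₀ (fun z => f z + f' z) (v + v') := by
  simp only [HasKernelResidue, mul_add]
  refine ⟨h.1.fun_add h'.1, ?_⟩
  rw [circleIntegral.integral_add h.1 h'.1, mul_add, h.2, h'.2]

theorem HasKernelResidue.sum {ε : ℝ} {z₀ : ℂ} {ι : Type*} {s : Finset ι} {f : ι → ℂ → ℂ}
    {v : ι → ℂ} (h : ∀ i ∈ s, HasKernelResidue ε z₀ (f i) (v i)) :
    HasKernelResidue ε z₀ (fun z => ∑ i ∈ s, f i z) (∑ i ∈ s, v i) := by
  simp only [HasKernelResidue, mul_sum]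
  refine ⟨CircleIntegrable.fun_sum s fun i hi => (h i hi).1, ?_⟩
  rw [circleIntegral.integral_fun_sum fun i hi => (h i hi).1, mul_sum]
  exact sum_congr rfl fun i hi => (h i hi).2

theorem HasKernelResidue.const_mul {ε : ℝ} {z₀ : ℂ} {f : ℂ → ℂ} {v : ℂ}
    (h : HasKernelResidue ε z₀ f v) (c : ℂ) :
    HasKernelResidue ε z₀ (fun z => c * f z) (c * v) := by
  simp only [HasKernelResidue, mul_left_comm _ c]
  refine ⟨h.1.const_fun_smul, ?_⟩
  rw [circleIntegral.integral_const_mul, mul_left_comm, h.2]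

theorem EvenSeriesOn.hasKernelResidue {ε : ℝ} (hε : 0 < ε) {z₀ : ℂ} {F : ℂ → ℂ} {c : ℕ → ℂ}
    (hF : EvenSeriesOn ε (fun z => F z * (1 / (z₀ ^ 2 - z ^ 2))) c) (m : ℕ) :
    HasKernelResidue ε z₀ (fun z => F z * (z ^ (2 * m))⁻¹) (1 / 2 * c m) := by
  have heq : (fun z => 1 / (2 * z * (z₀ ^ 2 - z ^ 2)) * (F z * (z ^ (2 * m))⁻¹)) =
      fun z => 1 / 2 * (F z * (1 / (z₀ ^ 2 - z ^ 2)) * (z ^ (2 * m + 1))⁻¹) := by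
    ext z
    simp only [one_div, mul_inv, pow_succ]
    ring
  have hc := hF.circleIntegral hε m
  rw [HasKernelResidue, heq, circleIntegral.integral_const_mul, hc.2]
  refine ⟨hc.1.const_fun_smul, ?_⟩
  have := Complex.two_pi_I_ne_zero
  field_simp

theorem hasKernelResidue_inv_pow {ε : ℝ} (hε : 0 < ε) {z₀ : ℂ} (h₀ : ε < ‖z₀‖) (m : ℕ) :
    HasKernelResidue ε z₀ (fun z => (z ^ (2 * m))⁻¹) (1 / 2 * (z₀ ^ (2 * m + 2))⁻¹) := by
  have h : EvenSeriesOn ε (fun z => 1 * (1 / (z₀ ^ 2 - z ^ 2)))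
      (fun k => (z₀ ^ (2 * k + 2))⁻¹) := by
    simpa only [one_mul] using evenSeriesOn_kernel hε h₀
  simpa only [one_mul] using h.hasKernelResidue hε m

theorem hasKernelResidue_bergman {ε : ℝ} (hε : 0 < ε) {z₀ w : ℂ} (h₀ : ε < ‖z₀‖) (hw : ε < ‖w‖)
    (m : ℕ) :
    HasKernelResidue ε z₀ (fun z => (1 / (z - w) ^ 2 + 1 / (-z - w) ^ 2) * (z ^ (2 * m))⁻¹)
      (∑ k ∈ antidiagonal m, (2 * k.1 + 1) * (w ^ (2 * k.1 + 2))⁻¹ * (z₀ ^ (2 * k.2 + 2))⁻¹) := by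
  convert! ((evenSeriesOn_bergman hε hw).mul hε
    (evenSeriesOn_kernel hε h₀)).hasKernelResidue hε m using 1
  rw [mul_sum]
  refine sum_congr rfl fun k _ => ?_
  ring

theorem sum_fin_fin_eq_sum_antidiagonal {N : ℕ} {G : ℕ → ℕ → ℂ}
    (hG : ∀ x y, N ≤ x + y → G x y = 0) :
    ∑ x : Fin N, ∑ y : Fin N, G x y = ∑ m ∈ range N, ∑ k ∈ antidiagonal m, G k.1 k.2 := by
  rw [← Finset.sum_range fun x => ∑ y : Fin N, G x y]
  have hrange : ∀ x, ∑ y : Fin N, G x y = ∑ y ∈ range N, G x y :=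
    fun x => (Finset.sum_range (G x)).symm
  simp only [hrange]
  rw [← sum_product' (range N) (range N) G, sum_sigma' (range N) antidiagonal,
    ← sum_filter_of_ne (p := fun k : ℕ × ℕ => k.1 + k.2 < N) fun k _ hk => by
      by_contra hlt
      exact hk (hG _ _ (not_lt.1 hlt))]
  refine sum_nbij' (fun k => ⟨k.1 + k.2, k⟩) (fun s => s.2) ?_ ?_ ?_ ?_ ?_
  · rintro ⟨x, y⟩ h
    simp at h ⊢
    omega
  · rintro ⟨m, x, y⟩ h
    simp at h ⊢
    omega
  · simp
  · rintro ⟨m, x, y⟩ h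
    simp at h ⊢
    exact h.2
  · simp

/-- Resummation of the terms of the recursion that merge two points. -/
theorem sum_fin_fin_merge {N : ℕ} {f : ℤ → ℂ} (h : ℕ → ℕ → ℂ) (hneg : f (-1) = 0)
    (hlarge : ∀ b : ℕ, N ≤ b + 1 → f b = 0) :
    ∑ x : Fin N, ∑ y : Fin N, h x y * f ((x : ℕ) + (y : ℕ) - 1) =
      ∑ b : Fin N, f (b : ℕ) * ∑ k ∈ antidiagonal ((b : ℕ) + 1), h k.2 k.1 := by
  have hlast : ∀ m : ℕ, N ≤ m → f ((m : ℤ) - 1) = 0 := by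
    rintro (_ | m) hm
    · simpa using hneg
    · have := hlarge m hm
      simpa using this
  rw [sum_fin_fin_eq_sum_antidiagonal (G := fun x y => h x y * f ((x : ℤ) + y - 1))
    fun x y hxy => by
      have := hlast (x + y) hxy
      push_cast at this
      rw [this, mul_zero],
    ← Finset.sum_range fun b => f (b : ℕ) * ∑ k ∈ antidiagonal (b + 1), h k.2 k.1]
  have hterm : ∀ m : ℕ, ∑ k ∈ antidiagonal m, h k.1 k.2 * f ((k.1 : ℤ) + k.2 - 1) =
      f ((m : ℤ) - 1) * ∑ k ∈ antidiagonal m, h k.2 k.1 := by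
    intro m
    rw [← Finset.Nat.sum_antidiagonal_swap, mul_sum]
    refine sum_congr rfl fun k hk => ?_
    have hk' : ((k.2 : ℤ) + k.1) = m := by
      rw [← mem_antidiagonal.1 hk]; push_cast; ring
    simp only [Prod.fst_swap, Prod.snd_swap]
    rw [hk', mul_comm]
  simp only [hterm]
  have h1 := sum_range_succ (fun m : ℕ => f ((m : ℤ) - 1) * ∑ k ∈ antidiagonal m, h k.2 k.1) N
  rw [hlast N le_rfl, zero_mul, add_zero] at h1
  rw [← h1, sum_range_succ']
  simp [hneg]

/-- Resummation of the terms of the recursion that split one point into two. -/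
theorem sum_fin_split {N : ℕ} {C : ℤ → ℤ → ℂ} (φ : ℕ → ℂ)
    (hlarge : ∀ x y : ℕ, N ≤ x + y + 2 → C x y = 0) :
    ∑ m : Fin N, φ m * ∑ b ∈ Finset.Icc (0 : ℤ) (((m : ℕ) : ℤ) - 2), C b (((m : ℕ) : ℤ) - 2 - b) =
      ∑ x : Fin N, ∑ y : Fin N, C (x : ℕ) (y : ℕ) * φ (x + y + 2) := by
  rw [sum_fin_fin_eq_sum_antidiagonal (G := fun x y => C x y * φ (x + y + 2)) fun x y hxy => by
      rw [hlarge x y (by omega), zero_mul],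
    ← Finset.sum_range fun m : ℕ => φ m * ∑ b ∈ Finset.Icc (0 : ℤ) ((m : ℤ) - 2),
      C b ((m : ℤ) - 2 - b)]
  have hIcc : ∀ m : ℕ, ∑ b ∈ Finset.Icc (0 : ℤ) (((m + 2 : ℕ) : ℤ) - 2),
      C b (((m + 2 : ℕ) : ℤ) - 2 - b) = ∑ k ∈ antidiagonal m, C k.1 k.2 := by
    intro m
    refine sum_nbij' (fun b => (b.toNat, m - b.toNat)) (fun k => (k.1 : ℤ)) ?_ ?_ ?_ ?_ ?_
    · intro b hb
      simp at hb ⊢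
      omega
    · intro k hk
      simp at hk ⊢
      omega
    · intro b hb
      simp at hb ⊢
      omega
    · rintro ⟨x, y⟩ hk
      simp at hk ⊢
      omega
    · intro b hb
      simp at hb
      congr 1 <;> push_cast <;> omega
  have hzero : ∀ m : ℕ, N ≤ m + 2 → ∑ k ∈ antidiagonal m, C k.1 k.2 = 0 := fun m hm =>
    sum_eq_zero fun k hk => hlarge _ _ (by rw [mem_antidiagonal.1 hk]; exact hm)
  have hext : ∑ m ∈ range N, φ m * ∑ b ∈ Finset.Icc (0 : ℤ) ((m : ℤ) - 2), C b ((m : ℤ) - 2 - b) =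
      ∑ m ∈ range (N + 2), φ m * ∑ b ∈ Finset.Icc (0 : ℤ) ((m : ℤ) - 2),
        C b ((m : ℤ) - 2 - b) := by
    refine sum_subset (by simp) fun m _ hm => ?_
    simp only [mem_range, not_lt] at hm
    rcases Nat.lt_or_ge m 2 with hm2 | hm2
    · rw [Finset.Icc_eq_empty (by omega), sum_empty, mul_zero]
    · obtain ⟨k, rfl⟩ := Nat.exists_eq_add_of_le' hm2
      rw [hIcc, hzero k hm, mul_zero]
  rw [hext, sum_range_succ', sum_range_succ']
  simp only [add_assoc, Nat.reduceAdd, hIcc]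
  simp only [CharP.cast_eq_zero, Nat.cast_one]
  rw [Finset.Icc_eq_empty (by omega), Finset.Icc_eq_empty (by omega)]
  simp only [sum_empty, mul_zero, add_zero]
  refine sum_congr rfl fun m _ => ?_
  rw [mul_sum]
  refine sum_congr rfl fun k hk => ?_
  rw [← mem_antidiagonal.1 hk, mul_comm, add_assoc]

/-- The values of `x` at the elements of `A`, listed in increasing order. -/
def restrictTo {n : ℕ} {α : Type*} (A : Finset (Fin n)) (x : Fin n → α) : Fin A.card → α :=
  fun j => x (A.orderIsoOfFin rfl j).1

/-- The integer multi-index underlying a bounded one. -/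
def toIndex {m N : ℕ} (a : Fin m → Fin N) : Fin m → ℤ := fun i => ((a i : ℕ) : ℤ)

/-- The monomial `∏ zᵢ^{-(2aᵢ+2)}`. -/
noncomputable def monomial {m N : ℕ} (z : Fin m → ℂ) (a : Fin m → Fin N) : ℂ :=
  ∏ i, (z i ^ (2 * (a i : ℕ) + 2))⁻¹

/-- The sum defining `tW`, over all multi-indices with entries below `N`. -/
noncomputable def stableW (τ : ℤ → (n : ℕ) → (Fin n → ℤ) → ℝ) (N : ℕ) (g : ℤ) (m : ℕ)
    (z : Fin m → ℂ) : ℂ :=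
  ∑ a : Fin m → Fin N, (ttau τ g m (toIndex a) : ℂ) * monomial z a

/-- The contribution of the unstable function `tW_{0,2}`. -/
noncomputable def pairW (g : ℤ) (m : ℕ) (z : Fin m → ℂ) : ℂ :=
  if h : g = 0 ∧ m = 2 then 1 / (z ⟨0, by omega⟩ - z ⟨1, by omega⟩) ^ 2 else 0

theorem ttau_eq_zero {τ : ℤ → (n : ℕ) → (Fin n → ℤ) → ℝ} (h : DVVFamily τ) {g : ℤ} {m : ℕ}
    {a : Fin m → ℤ}
    (ha : ¬((∀ i, 0 ≤ a i) ∧ 0 < 2 * g - 2 + (m : ℤ) ∧ (∑ i, a i) = 3 * g - 3 + m)) :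
    ttau τ g m a = 0 := by
  rw [ttau, h.vanish g m a ha, mul_zero]

theorem sum_toIndex_eq {m M N : ℕ} (hMN : M ≤ N) (F : (Fin m → ℤ) → (Fin m → ℕ) → ℂ)
    (hF : ∀ a : Fin m → ℕ, (∃ i, M ≤ a i) → F (fun i => (a i : ℤ)) a = 0) :
    ∑ a : Fin m → Fin M, F (toIndex a) (fun i => a i) =
      ∑ a : Fin m → Fin N, F (toIndex a) (fun i => a i) := by
  have key : ∀ K : ℕ, ∑ a : Fin m → Fin K, F (toIndex a) (fun i => a i) =
      ∑ a ∈ Fintype.piFinset fun _ : Fin m => range K, F (fun i => (a i : ℤ)) a := by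
    intro K
    refine sum_nbij (fun a i => (a i : ℕ)) ?_ ?_ ?_ ?_
    · intro a _
      simp
    · intro a _ b _ hab
      ext i
      exact congrFun hab i
    · intro a ha
      rw [mem_coe, Fintype.mem_piFinset] at ha
      exact ⟨fun i => ⟨a i, mem_range.1 (ha i)⟩, mem_coe.2 (mem_univ _), rfl⟩
    · intro a _
      rfl
  rw [key, key]
  refine sum_subset ?_ fun a _ ha => hF a ?_
  · exact Fintype.piFinset_subset _ _ fun _ => by simpa using hMN
  · simpa using ha

theorem tW_eq_stableW_add_pairW {τ : ℤ → (n : ℕ) → (Fin n → ℤ) → ℝ} (h : DVVFamily τ) {N : ℕ}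
    {g : ℤ} {m : ℕ} (hg : 0 ≤ g) (hN : 3 * g + m - 3 < N) (hN0 : 0 < N) (z : Fin m → ℂ) :
    tW τ g m z = stableW τ N g m z + pairW g m z := by
  by_cases hst : 0 ≤ g ∧ 0 < 2 * g - 2 + (m : ℤ)
  · have hne : ¬(g = 0 ∧ m = 2) := by omega
    rw [tW, pairW, dif_neg hne, dif_neg hne, if_pos hst, add_zero, stableW]
    have := sum_toIndex_eq (M := (3 * g + m - 3).toNat + 1) (N := N) (by omega)
      (fun a b => (ttau τ g m a : ℂ) * ∏ i : Fin m, (z i ^ (2 * b i + 2))⁻¹) (by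
        rintro a ⟨i, hi⟩
        rw [ttau_eq_zero h, Complex.ofReal_zero, zero_mul]
        rintro ⟨-, -, hsum⟩
        have := single_le_sum (f := fun i => (a i : ℤ)) (fun j _ => by positivity) (mem_univ i)
        omega)
    simp only [monomial]
    rw [← this]
    refine sum_congr rfl fun a _ => ?_
    simp only [ttau, toIndex, div_eq_mul_inv, prod_mul_distrib]
    push_cast
    rw [← mul_assoc, mul_comm ((τ g m _ : ℝ) : ℂ)]
    rfl
  · have hzero : stableW τ N g m z = 0 := sum_eq_zero fun a _ => by
      rw [ttau_eq_zero h, Complex.ofReal_zero, zero_mul]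
      rintro ⟨-, hpos, -⟩
      exact hst ⟨hg, hpos⟩
    rw [hzero, zero_add, tW, pairW, if_neg hst]

theorem sum_fin_succ_pi {m N : ℕ} {β : Type*} [AddCommMonoid β] (F : (Fin (m + 1) → Fin N) → β) :
    ∑ a, F a = ∑ b : Fin N, ∑ a : Fin m → Fin N, F (Fin.cons b a) := by
  rw [← Fintype.sum_prod_type' fun (b : Fin N) (a : Fin m → Fin N) => F (Fin.cons b a)]
  exact (Fintype.sum_equiv (Fin.consEquiv fun _ => Fin N) _ _ fun _ => rfl).symm

theorem toIndex_cons {m N : ℕ} (b : Fin N) (a : Fin m → Fin N) :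
    toIndex (Fin.cons b a : Fin (m + 1) → Fin N) = Fin.cons ((b : ℕ) : ℤ) (toIndex a) := by
  ext i
  refine Fin.cases ?_ (fun j => ?_) i <;> simp [toIndex]

theorem monomial_cons {m N : ℕ} (z : ℂ) (zs : Fin m → ℂ) (b : Fin N) (a : Fin m → Fin N) :
    monomial (Fin.cons z zs : Fin (m + 1) → ℂ) (Fin.cons b a : Fin (m + 1) → Fin N) =
      (z ^ (2 * (b : ℕ) + 2))⁻¹ * monomial zs a := by
  simp only [monomial, Fin.prod_univ_succ, Fin.cons_zero, Fin.cons_succ]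

theorem stableW_cons (τ : ℤ → (n : ℕ) → (Fin n → ℤ) → ℝ) (N : ℕ) (g : ℤ) (m : ℕ) (z : ℂ)
    (zs : Fin m → ℂ) :
    stableW τ N g (m + 1) (Fin.cons z zs) =
      ∑ b : Fin N, ∑ a : Fin m → Fin N,
        (ttau τ g (m + 1) (Fin.cons ((b : ℕ) : ℤ) (toIndex a)) : ℂ) * monomial zs a *
          (z ^ (2 * (b : ℕ) + 2))⁻¹ := by
  rw [stableW, sum_fin_succ_pi]
  simp only [toIndex_cons, monomial_cons]
  refine sum_congr rfl fun b _ => sum_congr rfl fun a _ => ?_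
  ring

theorem stableW_cons_neg (τ : ℤ → (n : ℕ) → (Fin n → ℤ) → ℝ) (N : ℕ) (g : ℤ) (m : ℕ) (z : ℂ)
    (zs : Fin m → ℂ) :
    stableW τ N g (m + 1) (Fin.cons (-z) zs) = stableW τ N g (m + 1) (Fin.cons z zs) := by
  simp only [stableW_cons]
  refine sum_congr rfl fun b _ => sum_congr rfl fun a _ => ?_
  rw [Even.neg_pow ⟨(b : ℕ) + 1, by ring⟩]

theorem stableW_cons_cons_neg (τ : ℤ → (n : ℕ) → (Fin n → ℤ) → ℝ) (N : ℕ) (g : ℤ) (m : ℕ) (z : ℂ)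
    (zs : Fin m → ℂ) :
    stableW τ N g (m + 2) (Fin.cons z (Fin.cons (-z) zs)) =
      ∑ p : (Fin m → Fin N) × Fin N × Fin N,
        (ttau τ g (m + 2) (Fin.cons ((p.2.1 : ℕ) : ℤ)
          (Fin.cons ((p.2.2 : ℕ) : ℤ) (toIndex p.1))) : ℂ) * monomial zs p.1 *
          (z ^ (2 * ((p.2.1 : ℕ) + (p.2.2 : ℕ) + 2)))⁻¹ := by
  rw [stableW_cons, Fintype.sum_prod_type_right, Fintype.sum_prod_type]
  refine sum_congr rfl fun b _ => ?_
  rw [sum_fin_succ_pi]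
  refine sum_congr rfl fun b' _ => sum_congr rfl fun a _ => ?_
  rw [toIndex_cons, monomial_cons, Even.neg_pow ⟨(b' : ℕ) + 1, by ring⟩,
    show 2 * ((b : ℕ) + (b' : ℕ) + 2) = (2 * (b : ℕ) + 2) + (2 * (b' : ℕ) + 2) by ring,
    pow_add z, mul_inv]
  ring

theorem sum_pi_split {n N : ℕ} (A : Finset (Fin n)) {β : Type*} [AddCommMonoid β]
    (F : (Fin A.card → Fin N) → (Fin Aᶜ.card → Fin N) → β) :
    ∑ a : Fin n → Fin N, F (restrictTo A a) (restrictTo Aᶜ a) = ∑ a, ∑ a', F a a' := by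
  rw [← Fintype.sum_prod_type']
  refine Fintype.sum_equiv (((finSumEquivOfFinset (s := A) rfl rfl).symm.arrowCongr
    (Equiv.refl (Fin N))).trans (Equiv.sumArrowEquivProdArrow _ _ _)) _ _ fun a => ?_
  rfl

theorem monomial_split {n N : ℕ} (A : Finset (Fin n)) (z : Fin n → ℂ) (a : Fin n → Fin N) :
    monomial z a = monomial (restrictTo A z) (restrictTo A a) *
      monomial (restrictTo Aᶜ z) (restrictTo Aᶜ a) := by
  rw [monomial, ← (finSumEquivOfFinset (s := A) rfl rfl).prod_comp, Fintype.prod_sum_type]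
  rfl

theorem stableW_mul_stableW (τ : ℤ → (n : ℕ) → (Fin n → ℤ) → ℝ) (N : ℕ) (g g' : ℤ) {n : ℕ}
    (A : Finset (Fin n)) (z : ℂ) (zs : Fin n → ℂ) :
    stableW τ N g (A.card + 1) (Fin.cons z (restrictTo A zs)) *
        stableW τ N g' (Aᶜ.card + 1) (Fin.cons (-z) (restrictTo Aᶜ zs)) =
      ∑ p : (Fin n → Fin N) × Fin N × Fin N,
        (ttau τ g (A.card + 1) (Fin.cons ((p.2.1 : ℕ) : ℤ) (restrictTo A (toIndex p.1))) : ℂ) *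
          (ttau τ g' (Aᶜ.card + 1)
            (Fin.cons ((p.2.2 : ℕ) : ℤ) (restrictTo Aᶜ (toIndex p.1))) : ℂ) *
          monomial zs p.1 * (z ^ (2 * ((p.2.1 : ℕ) + (p.2.2 : ℕ) + 2)))⁻¹ := by
  rw [stableW_cons_neg, stableW_cons, stableW_cons, sum_mul_sum, Fintype.sum_prod_type_right,
    Fintype.sum_prod_type]
  refine sum_congr rfl fun b _ => sum_congr rfl fun b' _ => ?_
  rw [sum_mul_sum, ← sum_pi_split A]
  refine sum_congr rfl fun a _ => ?_
  rw [monomial_split A zs a]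
  have e1 : toIndex (restrictTo A a) = restrictTo A (toIndex a) := rfl
  have e2 : toIndex (restrictTo Aᶜ a) = restrictTo Aᶜ (toIndex a) := rfl
  rw [e1, e2, show 2 * ((b : ℕ) + (b' : ℕ) + 2) = (2 * (b : ℕ) + 2) + (2 * (b' : ℕ) + 2) by ring,
    pow_add z, mul_inv]
  ring

theorem exists_perm_of_map_univ_eq {m : ℕ} {a a' : Fin m → ℤ}
    (h : univ.val.map a = univ.val.map a') : ∃ σ : Equiv.Perm (Fin m), a ∘ σ = a' := by
  have hsort : ∀ b : Fin m → ℤ, (List.ofFn (b ∘ Tuple.sort b)).Pairwise (· ≤ ·) := fun b =>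
    (Tuple.monotone_sort b).sortedLE_ofFn.pairwise
  have hperm : (List.ofFn (a ∘ Tuple.sort a)).Perm (List.ofFn (a' ∘ Tuple.sort a')) := by
    refine ((Tuple.sort a).ofFn_comp_perm a).trans (List.Perm.trans ?_
      ((Tuple.sort a').ofFn_comp_perm a').symm)
    simpa [Fin.univ_val_map] using h
  have heq := List.ofFn_injective (hperm.eq_of_pairwise' (hsort a) (hsort a'))
  refine ⟨(Tuple.sort a').symm.trans (Tuple.sort a), ?_⟩
  ext i
  simpa using congrFun heq ((Tuple.sort a').symm i)

theorem ttau_congr {τ : ℤ → (n : ℕ) → (Fin n → ℤ) → ℝ} (h : DVVFamily τ) (g : ℤ) {m m' : ℕ}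
    {a : Fin m → ℤ} {a' : Fin m' → ℤ} (ha : univ.val.map a = univ.val.map a') :
    ttau τ g m a = ttau τ g m' a' := by
  obtain rfl : m = m' := by simpa using congrArg Multiset.card ha
  obtain ⟨σ, rfl⟩ := exists_perm_of_map_univ_eq ha
  rw [ttau, ttau, h.symm]
  congr 1
  exact (Equiv.prod_comp σ fun i => dfac (2 * a i + 1)).symm

/-- The correlator as a function of the multiset of its indices. -/
noncomputable def corr (τ : ℤ → (n : ℕ) → (Fin n → ℤ) → ℝ) (g : ℤ) (s : Multiset ℤ) : ℝ :=
  ttau τ g s.toList.length s.toList.get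

theorem map_univ_toList_get (s : Multiset ℤ) : univ.val.map s.toList.get = s := by
  rw [Fin.univ_val_map, List.ofFn_get, Multiset.coe_toList]

theorem ttau_eq_corr {τ : ℤ → (n : ℕ) → (Fin n → ℤ) → ℝ} (h : DVVFamily τ) (g : ℤ) {m : ℕ}
    (a : Fin m → ℤ) : ttau τ g m a = corr τ g (univ.val.map a) :=
  ttau_congr h g (map_univ_toList_get _).symm

theorem map_univ_cons {α : Type*} {m : ℕ} (b : α) (a : Fin m → α) :
    univ.val.map (Fin.cons b a : Fin (m + 1) → α) = b ::ₘ univ.val.map a := by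
  simp [Fin.univ_val_map, List.ofFn_succ]

theorem map_univ_restrictTo {α : Type*} {n : ℕ} (A : Finset (Fin n)) (a : Fin n → α) :
    univ.val.map (restrictTo A a) = A.val.map a := by
  have : (univ.map (A.orderEmbOfFin rfl).toEmbedding).val = A.val := by
    rw [Finset.map_orderEmbOfFin_univ]
  rw [← this, Finset.map_val, Multiset.map_map]
  rfl

theorem map_univ_update {ι α : Type*} [Fintype ι] [DecidableEq ι] (a : ι → α) (i : ι) (x : α) :
    univ.val.map (Function.update a i x) = x ::ₘ (univ.erase i).val.map a := by
  rw [← Finset.insert_erase (mem_univ i), Finset.insert_val_of_notMem (notMem_erase i univ),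
    Multiset.map_cons, Function.update_self, erase_insert (notMem_erase i univ)]
  congr 1
  refine Multiset.map_congr rfl fun j hj => ?_
  rw [Function.update_of_ne (ne_of_mem_erase hj)]

theorem corr_eq_zero {τ : ℤ → (n : ℕ) → (Fin n → ℤ) → ℝ} (h : DVVFamily τ) {g : ℤ}
    {s : Multiset ℤ}
    (hs : ¬((∀ x ∈ s, 0 ≤ x) ∧ 0 < 2 * g - 2 + (s.card : ℤ) ∧ s.sum = 3 * g - 3 + s.card)) :
    corr τ g s = 0 := by
  refine ttau_eq_zero h fun ⟨h1, h2, h3⟩ => hs ⟨fun x hx => ?_, ?_, ?_⟩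
  · obtain ⟨i, rfl⟩ := List.mem_iff_get.1 (Multiset.mem_toList.2 hx)
    exact h1 i
  · simpa using h2
  · have : ∑ i, s.toList.get i = s.sum := by
      conv_rhs => rw [← map_univ_toList_get s]
      rfl
    rw [← this, h3, Multiset.length_toList]

/-- The properties of genus zero correlators from which the full genus zero recursion
follows. -/
structure GenusZero (c : Multiset ℤ → ℝ) : Prop where
  eq_zero : ∀ s : Multiset ℤ,
    ¬((∀ x ∈ s, 0 ≤ x) ∧ 3 ≤ s.card ∧ s.sum = (s.card : ℤ) - 3) → c s = 0
  three : c {0, 0, 0} = 1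
  low : ∀ a₀ : ℤ, 0 ≤ a₀ → a₀ ≤ 1 → ∀ s : Multiset ℤ, 3 ≤ s.card → (∀ x ∈ s, 0 ≤ x) →
    c (a₀ ::ₘ s) = (s.map fun x : ℤ => (2 * (x : ℝ) + 1) * c ((a₀ + x - 1) ::ₘ s.erase x)).sum

theorem genusZero_corr {τ : ℤ → (n : ℕ) → (Fin n → ℤ) → ℝ} (h : DVVFamily τ)
    (hbase : τ 0 3 (fun _ => 0) = 1) : GenusZero (corr τ 0) where
  eq_zero s hs := corr_eq_zero h fun ⟨h1, h2, h3⟩ => hs ⟨h1, by omega, by omega⟩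
  three := by
    have h3 : ({0, 0, 0} : Multiset ℤ) = univ.val.map (fun _ : Fin 3 => (0 : ℤ)) := rfl
    rw [h3, ← ttau_eq_corr h, ttau, hbase]
    simp [dfac]
  low a₀ h0 h1 s hs hpos := by
    obtain ⟨m, a, rfl⟩ : ∃ (m : ℕ) (a : Fin m → ℤ), univ.val.map a = s :=
      ⟨_, _, map_univ_toList_get s⟩
    have hm : 3 ≤ m := by simpa using hs
    have := h.dvv 0 m le_rfl (by omega) a₀ a h0 fun i => hpos _ (by simp)
    rw [Finset.Icc_eq_empty (by omega), sum_empty, mul_zero, add_zero, ttau_eq_corr h,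
      map_univ_cons] at this
    rw [this, Multiset.map_map]
    refine sum_congr rfl fun i _ => ?_
    rw [ttau_eq_corr h, map_univ_update, Function.comp_apply]
    congr 3
    conv_rhs => rw [← Finset.insert_erase (mem_univ i),
      Finset.insert_val_of_notMem (notMem_erase i univ), Multiset.map_cons]
    rw [Multiset.erase_cons_head]

section GenusZero

variable {ι : Type*} {c : Multiset ℤ → ℝ}

/-- The correlator with one distinguished index `b` and the indices `aᵢ` for `i ∈ I`. -/
def corrOn (c : Multiset ℤ → ℝ) (b : ℤ) (I : Finset ι) (a : ι → ℤ) : ℝ :=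
  c (b ::ₘ I.val.map a)

theorem corrOn_congr {b : ℤ} {I : Finset ι} {a a' : ι → ℤ} (h : ∀ i ∈ I, a i = a' i) :
    corrOn c b I a = corrOn c b I a' := by
  rw [corrOn, corrOn, Multiset.map_congr rfl h]

theorem GenusZero.corrOn_eq_zero (hc : GenusZero c) {b : ℤ} {I : Finset ι} {a : ι → ℤ}
    (h : ¬(0 ≤ b ∧ (∀ i ∈ I, 0 ≤ a i) ∧ 2 ≤ #I ∧ b + ∑ i ∈ I, a i = (#I : ℤ) - 2)) :
    corrOn c b I a = 0 := by
  refine hc.eq_zero _ fun ⟨h1, h2, h3⟩ => h ⟨h1 b (by simp), fun i hi => h1 _ ?_, ?_, ?_⟩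
  · exact Multiset.mem_cons_of_mem (Multiset.mem_map_of_mem a hi)
  · simpa using h2
  · rw [Multiset.sum_cons, Multiset.card_cons, Multiset.card_map] at h3
    push_cast at h3
    change b + ∑ i ∈ I, a i = _ at h3
    rw [h3, Finset.card_def]
    ring

variable [DecidableEq ι]

/-- The multi-index `a - eⱼ`. -/
def lower (a : ι → ℤ) (j : ι) : ι → ℤ := Function.update a j (a j - 1)

/-- The terms of the recursion in which the distinguished index merges with another one. -/
def mergeSum (c : Multiset ℤ → ℝ) (x : ℤ) (I : Finset ι) (a : ι → ℤ) : ℝ :=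
  ∑ i ∈ I, (2 * (a i : ℝ) + 1) * corrOn c (x + a i - 1) (I.erase i) a

/-- The terms of the recursion in which the distinguished index splits. -/
noncomputable def splitSum (c : Multiset ℤ → ℝ) (p : ℤ) (I : Finset ι) (a : ι → ℤ) : ℝ :=
  ∑ b ∈ Finset.Icc (0 : ℤ) p, ∑ A ∈ I.powerset, corrOn c b A a * corrOn c (p - b) (I \ A) a

theorem map_insert_val {α : Type*} {k : ι} {I : Finset ι} (hk : k ∉ I) (a : ι → α) :
    (insert k I).val.map a = a k ::ₘ I.val.map a := by
  rw [Finset.insert_val_of_notMem hk, Multiset.map_cons]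

theorem map_val_erase {α : Type*} [DecidableEq α] {i : ι} {I : Finset ι} (hi : i ∈ I)
    (a : ι → α) : (I.val.map a).erase (a i) = (I.erase i).val.map a := by
  conv_lhs => rw [← Finset.insert_erase hi, map_insert_val (notMem_erase i I)]
  rw [Multiset.erase_cons_head]

theorem lower_of_ne (a : ι → ℤ) {i j : ι} (h : i ≠ j) : lower a j i = a i :=
  Function.update_of_ne h _ _

theorem lower_self (a : ι → ℤ) (j : ι) : lower a j j = a j - 1 :=
  Function.update_self _ _ _

theorem corrOn_lower {b : ℤ} {I : Finset ι} (a : ι → ℤ) {j : ι} (hj : j ∉ I) :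
    corrOn c b I (lower a j) = corrOn c b I a :=
  corrOn_congr fun _ hi => lower_of_ne a fun h => hj (h ▸ hi)

theorem GenusZero.corrOn_low (hc : GenusZero c) {x : ℤ} (h0 : 0 ≤ x) (h1 : x ≤ 1)
    {I : Finset ι} (hI : 3 ≤ #I) {a : ι → ℤ} (ha : ∀ i ∈ I, 0 ≤ a i) :
    corrOn c x I a = mergeSum c x I a := by
  rw [corrOn, hc.low x h0 h1 _ (by simpa using hI) (by simpa using ha), Multiset.map_map]
  refine sum_congr rfl fun i hi => ?_
  rw [Function.comp_apply, map_val_erase hi, corrOn]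

/-- The correction to the string equation coming from `⟨τ₀τ₀τ₀⟩₀`. -/
def stringDefect (b : ℤ) (A : Finset ι) (a : ι → ℤ) : ℝ :=
  ∑ j ∈ A, if A = {j} ∧ b = 0 ∧ a j = 0 then 1 else 0

theorem GenusZero.string (hc : GenusZero c) {b : ℤ} (hb : 0 ≤ b) {A : Finset ι} {k : ι}
    (hk : k ∉ A) {a : ι → ℤ} (hak : a k = 0) (ha : ∀ i ∈ A, 0 ≤ a i) :
    corrOn c b (insert k A) a = (2 * (b : ℝ) + 1) * corrOn c (b - 1) A a +
      ∑ j ∈ A, (2 * (a j : ℝ) + 1) * corrOn c b A (lower a j) + stringDefect b A a := by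
  rcases le_or_gt 2 #A with h2 | h2
  · have hdef : stringDefect b A a = 0 := sum_eq_zero fun j _ => if_neg fun h => by
      rw [h.1, card_singleton] at h2
      omega
    rw [hdef, add_zero, corrOn, map_insert_val hk, Multiset.cons_swap, hak,
      hc.low 0 le_rfl zero_le_one _ (by simpa using h2) (by simpa using ⟨hb, ha⟩),
      Multiset.map_cons, Multiset.sum_cons, Multiset.erase_cons_head, zero_add,
      Multiset.map_map]
    congr 1
    refine sum_congr rfl fun j hj => ?_
    rw [Function.comp_apply, Multiset.erase_cons_tail_of_mem (Multiset.mem_map_of_mem a hj),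
      map_val_erase hj, zero_add, Multiset.cons_swap, corrOn]
    congr 3
    conv_rhs => rw [← Finset.insert_erase hj, map_insert_val (notMem_erase j A), lower_self]
    congr 1
    exact Multiset.map_congr rfl fun i hi => (lower_of_ne a (ne_of_mem_erase hi)).symm
  · have hzero : ∀ b' a', corrOn c b' A a' = 0 := fun b' a' =>
      hc.corrOn_eq_zero fun h => by omega
    simp only [hzero, mul_zero, sum_const_zero, zero_add]
    rcases (by omega : #A = 0 ∨ #A = 1) with h | h
    · rw [card_eq_zero.1 h]
      simp only [stringDefect, sum_empty]
      exact hc.corrOn_eq_zero fun h => by simp at h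
    · obtain ⟨j, rfl⟩ := card_eq_one.1 h
      simp only [stringDefect, sum_singleton, true_and]
      split_ifs with h0
      · rw [corrOn, map_insert_val hk, hak, h0.1]
        simpa [h0.2] using hc.three
      · refine hc.corrOn_eq_zero fun ⟨_, h1, _, h3⟩ => h0 ?_
        rw [sum_insert hk, sum_singleton, hak, card_insert_of_notMem hk, card_singleton] at h3
        have := ha j (mem_singleton_self j)
        push_cast at h3
        constructor <;> omega

theorem sum_Icc_powerset_symm (p : ℤ) (J : Finset ι) (F : ℤ → Finset ι → ℝ) :
    ∑ b ∈ Finset.Icc (0 : ℤ) p, ∑ A ∈ J.powerset, F (p - b) (J \ A) =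
      ∑ b ∈ Finset.Icc (0 : ℤ) p, ∑ A ∈ J.powerset, F b A := by
  refine sum_nbij' (fun b => p - b) (fun b => p - b) ?_ ?_ ?_ ?_ fun b _ => ?_
  · intro b hb
    rw [Finset.mem_Icc] at hb ⊢
    omega
  · intro b hb
    rw [Finset.mem_Icc] at hb ⊢
    omega
  · intro b _
    exact sub_sub_cancel p b
  · intro b _
    exact sub_sub_cancel p b
  · refine sum_nbij' (fun A => J \ A) (fun A => J \ A) ?_ ?_ ?_ ?_ fun A _ => rfl
    · intro A _
      exact mem_powerset.2 sdiff_subset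
    · intro A _
      exact mem_powerset.2 sdiff_subset
    · intro A hA
      exact Finset.sdiff_sdiff_eq_self (mem_powerset.1 hA)
    · intro A hA
      exact Finset.sdiff_sdiff_eq_self (mem_powerset.1 hA)

theorem sum_powerset_sum_mem (J : Finset ι) (X : ι → Finset ι → ℝ) :
    ∑ A ∈ J.powerset, ∑ j ∈ A, X j A =
      ∑ j ∈ J, ∑ A ∈ J.powerset, if j ∈ A then X j A else 0 := by
  rw [sum_comm (s := J)]
  refine sum_congr rfl fun A hA => ?_
  rw [← sum_filter, filter_mem_eq_inter, inter_eq_right.2 (mem_powerset.1 hA)]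

theorem splitSum_insert {p : ℤ} {J : Finset ι} {k : ι} (hk : k ∉ J) (a : ι → ℤ) :
    splitSum c p (insert k J) a = 2 * ∑ b ∈ Finset.Icc (0 : ℤ) p, ∑ A ∈ J.powerset,
      corrOn c b (insert k A) a * corrOn c (p - b) (J \ A) a := by
  have h := sum_Icc_powerset_symm p J fun b A =>
    corrOn c b (insert k A) a * corrOn c (p - b) (J \ A) a
  rw [two_mul]
  nth_rw 1 [← h]
  rw [splitSum, ← sum_add_distrib]
  refine sum_congr rfl fun b _ => ?_
  rw [sum_powerset_insert hk]
  congr 1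
  · refine sum_congr rfl fun A hA => ?_
    rw [mem_powerset] at hA
    rw [insert_sdiff_of_notMem _ fun h => hk (hA h), Finset.sdiff_sdiff_eq_self hA,
      sub_sub_cancel, mul_comm]
  · refine sum_congr rfl fun A hA => ?_
    rw [mem_powerset] at hA
    suffices hset : insert k J \ insert k A = J \ A by rw [hset]
    ext x
    simp only [Finset.mem_sdiff, Finset.mem_insert, not_or]
    constructor
    · rintro ⟨h1, h2, h3⟩
      exact ⟨h1.resolve_left h2, h3⟩
    · rintro ⟨h1, h2⟩
      exact ⟨Or.inr h1, fun h => hk (h ▸ h1), h2⟩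

theorem splitSum_lower {p : ℤ} {J : Finset ι} (a : ι → ℤ) {j : ι} (hj : j ∈ J) :
    splitSum c p J (lower a j) = 2 * ∑ b ∈ Finset.Icc (0 : ℤ) p, ∑ A ∈ J.powerset,
      if j ∈ A then corrOn c b A (lower a j) * corrOn c (p - b) (J \ A) a else 0 := by
  have h := sum_Icc_powerset_symm p J fun b A =>
    if j ∈ A then corrOn c b A (lower a j) * corrOn c (p - b) (J \ A) a else 0
  rw [two_mul]
  nth_rw 2 [← h]
  rw [splitSum, ← sum_add_distrib]
  refine sum_congr rfl fun b _ => ?_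
  rw [← sum_add_distrib]
  refine sum_congr rfl fun A hA => ?_
  rw [mem_powerset] at hA
  by_cases hjA : j ∈ A
  · have hj' : j ∉ J \ A := fun h => (mem_sdiff.1 h).2 hjA
    rw [if_pos hjA, if_neg hj', add_zero, corrOn_lower a hj']
  · rw [if_neg hjA, if_pos (mem_sdiff.2 ⟨hj, hjA⟩), zero_add, Finset.sdiff_sdiff_eq_self hA,
      sub_sub_cancel, corrOn_lower a hjA, mul_comm]

theorem GenusZero.sum_weighted_split (hc : GenusZero c) {p : ℤ} (J : Finset ι) (a : ι → ℤ) :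
    ∑ b ∈ Finset.Icc (0 : ℤ) p, ∑ A ∈ J.powerset,
      (2 * (b : ℝ) + 1) * corrOn c (b - 1) A a * corrOn c (p - b) (J \ A) a =
      ((p : ℝ) + 2) * splitSum c (p - 1) J a := by
  have hshift : ∑ b ∈ Finset.Icc (0 : ℤ) p, ∑ A ∈ J.powerset,
      (2 * (b : ℝ) + 1) * corrOn c (b - 1) A a * corrOn c (p - b) (J \ A) a =
      ∑ b ∈ Finset.Icc (0 : ℤ) (p - 1), ∑ A ∈ J.powerset,
        (2 * (b : ℝ) + 3) * (corrOn c b A a * corrOn c (p - 1 - b) (J \ A) a) := by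
    have hsub : (Finset.Icc (1 : ℤ) p) ⊆ Finset.Icc 0 p :=
      Finset.Icc_subset_Icc_left zero_le_one
    rw [← sum_subset hsub]
    · refine sum_nbij' (fun b => b - 1) (fun b => b + 1) ?_ ?_ ?_ ?_ fun b _ => ?_
      · intro b hb
        rw [Finset.mem_Icc] at hb ⊢
        omega
      · intro b hb
        rw [Finset.mem_Icc] at hb ⊢
        omega
      · intro b _
        exact sub_add_cancel b 1
      · intro b _
        exact add_sub_cancel_right b 1
      · refine sum_congr rfl fun A _ => ?_
        rw [show p - 1 - (b - 1) = p - b by ring]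
        push_cast
        ring
    · intro b hb hb'
      rw [Finset.mem_Icc] at hb hb'
      refine sum_eq_zero fun A _ => ?_
      rw [hc.corrOn_eq_zero (b := b - 1) fun h => by omega, mul_zero, zero_mul]
  have hsymm := sum_Icc_powerset_symm (p - 1) J fun b A =>
    (2 * (b : ℝ) + 3) * (corrOn c b A a * corrOn c (p - 1 - b) (J \ A) a)
  have hadd : ∑ b ∈ Finset.Icc (0 : ℤ) (p - 1), ∑ A ∈ J.powerset,
        (2 * (b : ℝ) + 3) * (corrOn c b A a * corrOn c (p - 1 - b) (J \ A) a) +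
      ∑ b ∈ Finset.Icc (0 : ℤ) (p - 1), ∑ A ∈ J.powerset,
        (2 * ((p - 1 - b : ℤ) : ℝ) + 3) * (corrOn c (p - 1 - b) (J \ A) a *
          corrOn c (p - 1 - (p - 1 - b)) (J \ (J \ A)) a) =
      2 * (((p : ℝ) + 2) * splitSum c (p - 1) J a) := by
    rw [splitSum, mul_sum, mul_sum, ← sum_add_distrib]
    refine sum_congr rfl fun b _ => ?_
    rw [← sum_add_distrib, mul_sum, mul_sum]
    refine sum_congr rfl fun A hA => ?_
    rw [Finset.sdiff_sdiff_eq_self (mem_powerset.1 hA), sub_sub_cancel]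
    push_cast
    ring
  rw [hsymm] at hadd
  rw [hshift]
  linarith

theorem GenusZero.mergeSum_insert (hc : GenusZero c) {x : ℤ} (hx : 2 ≤ x) {J : Finset ι} {k : ι}
    (hk : k ∉ J) {a : ι → ℤ} (hak : a k = 0) (ha : ∀ i ∈ J, 0 ≤ a i) :
    mergeSum c x (insert k J) a = corrOn c (x - 1) J a +
      ∑ i ∈ J, (2 * (a i : ℝ) + 1) * ((2 * ((x + a i - 1 : ℤ) : ℝ) + 1) *
        corrOn c (x + a i - 2) (J.erase i) a) +
      ∑ j ∈ J, (2 * (a j : ℝ) + 1) * ∑ i ∈ J.erase j,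
        (2 * (a i : ℝ) + 1) * corrOn c (x + a i - 1) (J.erase i) (lower a j) := by
  rw [mergeSum, sum_insert hk, erase_insert hk, hak, add_zero, Int.cast_zero, mul_zero, zero_add,
    one_mul, add_assoc]
  congr 1
  have hswap : ∑ j ∈ J, (2 * (a j : ℝ) + 1) * ∑ i ∈ J.erase j,
        (2 * (a i : ℝ) + 1) * corrOn c (x + a i - 1) (J.erase i) (lower a j) =
      ∑ i ∈ J, (2 * (a i : ℝ) + 1) * ∑ j ∈ J.erase i,
        (2 * (a j : ℝ) + 1) * corrOn c (x + a i - 1) (J.erase i) (lower a j) := by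
    simp only [mul_sum]
    rw [sum_comm' (t' := J) (s' := fun i => J.erase i)]
    · refine sum_congr rfl fun i _ => sum_congr rfl fun j _ => ?_
      ring
    · intro i j
      simp only [mem_erase, ne_eq]
      tauto
  rw [hswap, ← sum_add_distrib]
  refine sum_congr rfl fun i hi => ?_
  have hne : i ≠ k := fun h => hk (h ▸ hi)
  have hi0 := ha i hi
  rw [erase_insert_of_ne hne.symm, hc.string (by omega) (fun h => hk (mem_of_mem_erase h)) hak
    fun j hj => ha j (mem_of_mem_erase hj)]
  have hdef : stringDefect (x + a i - 1) (J.erase i) a = 0 :=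
    sum_eq_zero fun j _ => if_neg fun h => by omega
  rw [hdef, add_zero, mul_add, show x + a i - 1 - 1 = x + a i - 2 by ring]

theorem sum_stringDefect {p : ℤ} (hp : 0 ≤ p) (J : Finset ι) (a : ι → ℤ) :
    ∑ b ∈ Finset.Icc (0 : ℤ) p, ∑ A ∈ J.powerset,
      stringDefect b A a * corrOn c (p - b) (J \ A) a =
      ∑ j ∈ J, if a j = 0 then corrOn c p (J.erase j) a else 0 := by
  rw [sum_eq_single_of_mem 0 (Finset.mem_Icc.2 ⟨le_rfl, hp⟩)]
  · simp only [stringDefect, sum_mul, sub_zero, true_and]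
    rw [sum_powerset_sum_mem J fun j A =>
      (if A = {j} ∧ a j = 0 then (1 : ℝ) else 0) * corrOn c p (J \ A) a]
    refine sum_congr rfl fun j hj => ?_
    rw [sum_eq_single_of_mem {j} (mem_powerset.2 (singleton_subset_iff.2 hj))]
    · simp [sdiff_singleton_eq_erase]
    · intro A _ hA
      simp [hA]
  · intro b _ hb
    refine sum_eq_zero fun A _ => ?_
    rw [stringDefect, sum_eq_zero fun j _ => if_neg fun h => hb h.2.1, zero_mul]

theorem GenusZero.splitSum_insert (hc : GenusZero c) {p : ℤ} (hp : 0 ≤ p) {J : Finset ι} {k : ι}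
    (hk : k ∉ J) {a : ι → ℤ} (hak : a k = 0) (ha : ∀ i ∈ J, 0 ≤ a i) :
    1 / 2 * splitSum c p (insert k J) a = ((p : ℝ) + 2) * splitSum c (p - 1) J a +
      ∑ j ∈ J, (2 * (a j : ℝ) + 1) * (1 / 2 * splitSum c p J (lower a j)) +
      ∑ j ∈ J, if a j = 0 then corrOn c p (J.erase j) a else 0 := by
  rw [AiryRecursion.splitSum_insert hk, ← hc.sum_weighted_split, ← sum_stringDefect hp,
    ← mul_assoc, one_div_mul_cancel two_ne_zero, one_mul]
  have hmid : ∑ j ∈ J, (2 * (a j : ℝ) + 1) * (1 / 2 * splitSum c p J (lower a j)) =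
      ∑ b ∈ Finset.Icc (0 : ℤ) p, ∑ A ∈ J.powerset, ∑ j ∈ A,
        (2 * (a j : ℝ) + 1) * corrOn c b A (lower a j) * corrOn c (p - b) (J \ A) a := by
    have h1 : ∀ b, ∑ A ∈ J.powerset, ∑ j ∈ A,
        (2 * (a j : ℝ) + 1) * corrOn c b A (lower a j) * corrOn c (p - b) (J \ A) a = _ :=
      fun b => sum_powerset_sum_mem J fun j A =>
        (2 * (a j : ℝ) + 1) * corrOn c b A (lower a j) * corrOn c (p - b) (J \ A) a
    simp only [h1]
    rw [sum_comm]
    refine sum_congr rfl fun j hj => ?_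
    rw [splitSum_lower a hj, ← mul_assoc (1 / 2 : ℝ), one_div_mul_cancel two_ne_zero, one_mul,
      mul_sum]
    refine sum_congr rfl fun b _ => ?_
    rw [mul_sum]
    refine sum_congr rfl fun A _ => ?_
    rw [mul_ite, mul_zero, mul_assoc]
  rw [hmid, ← sum_add_distrib, ← sum_add_distrib]
  refine sum_congr rfl fun b hb => ?_
  rw [← sum_add_distrib, ← sum_add_distrib]
  refine sum_congr rfl fun A hA => ?_
  rw [mem_powerset] at hA
  rw [hc.string (Finset.mem_Icc.1 hb).1 (fun h => hk (hA h)) hak fun i hi => ha i (hA hi),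
    add_mul, add_mul, sum_mul]

theorem mergeSum_lower {x : ℤ} {J : Finset ι} (a : ι → ℤ) {j : ι} (hj : j ∈ J) :
    mergeSum c x J (lower a j) =
      (∑ i ∈ J.erase j, (2 * (a i : ℝ) + 1) * corrOn c (x + a i - 1) (J.erase i) (lower a j)) +
        (2 * (a j : ℝ) - 1) * corrOn c (x + a j - 2) (J.erase j) a := by
  rw [mergeSum, ← sum_erase_add _ _ hj]
  congr 1
  · refine sum_congr rfl fun i hi => ?_
    rw [lower_of_ne a (ne_of_mem_erase hi)]
  · rw [corrOn_lower a (notMem_erase j J), lower_self, show x + (a j - 1) - 1 = x + a j - 2 by ring]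
    push_cast
    ring

theorem GenusZero.corrOn_lower_of_eq_zero (hc : GenusZero c) {J : Finset ι} {a : ι → ℤ}
    {j : ι} (hj : j ∈ J) (haj : a j = 0) (b : ℤ) : corrOn c b J (lower a j) = 0 :=
  hc.corrOn_eq_zero fun h => by
    have := h.2.1 j hj
    rw [lower_self] at this
    omega

/-- The genus zero recursion, without any contribution of negative genus. -/
theorem GenusZero.recursion (hc : GenusZero c) : ∀ (I : Finset ι) (a : ι → ℤ) (x : ℤ),
    2 ≤ #I → 1 ≤ x → (∀ i ∈ I, 0 ≤ a i) →
    corrOn c x I a = mergeSum c x I a + 1 / 2 * splitSum c (x - 2) I a := by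
  intro I
  induction I using Finset.strongInduction with | H I ih
  intro a x hI hx ha
  by_cases hdim : x + ∑ i ∈ I, a i = (#I : ℤ) - 2
  swap
  · rw [hc.corrOn_eq_zero fun h => hdim h.2.2.2]
    have hm : mergeSum c x I a = 0 := sum_eq_zero fun i hi => by
      rw [hc.corrOn_eq_zero, mul_zero]
      rintro ⟨-, -, -, h⟩
      rw [card_erase_of_mem hi, Nat.cast_sub (by omega)] at h
      have := add_sum_erase I a hi
      push_cast at h
      omega
    have hs : splitSum c (x - 2) I a = 0 := sum_eq_zero fun b _ => sum_eq_zero fun A hA => by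
      rw [mem_powerset] at hA
      by_cases h1 : b + ∑ i ∈ A, a i = (#A : ℤ) - 2
      · rw [hc.corrOn_eq_zero (I := I \ A), mul_zero]
        rintro ⟨-, -, -, h⟩
        have h2 := sum_sdiff (f := a) hA
        have h3 := card_sdiff_add_card_eq_card hA
        omega
      · rw [hc.corrOn_eq_zero fun h => h1 h.2.2.2, zero_mul]
    rw [hm, hs]
    ring
  have hsum : 0 ≤ ∑ i ∈ I, a i := sum_nonneg ha
  rcases eq_or_lt_of_le hx with rfl | hx2
  · rw [hc.corrOn_low zero_le_one le_rfl (by omega) ha, splitSum, Finset.Icc_eq_empty (by norm_num),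
      sum_empty]
    ring
  obtain ⟨k, hkI, hak⟩ : ∃ k ∈ I, a k = 0 := by
    by_contra! hne
    have h1 : ∑ i ∈ I, (1 : ℤ) ≤ ∑ i ∈ I, a i := sum_le_sum fun i hi => by
      have := ha i hi
      have := hne i hi
      omega
    rw [sum_const, nsmul_eq_mul, mul_one] at h1
    omega
  obtain ⟨J, hk, rfl⟩ : ∃ J, k ∉ J ∧ insert k J = I :=
    ⟨I.erase k, notMem_erase k I, insert_erase hkI⟩
  have haJ : ∀ i ∈ J, 0 ≤ a i := fun i hi => ha i (mem_insert_of_mem hi)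
  have hJ : 2 ≤ #J := by
    rw [card_insert_of_notMem hk] at hdim
    push_cast at hdim
    omega
  have hJI : J ⊂ insert k J := ssubset_insert hk
  have hlow : ∀ j ∈ J, corrOn c x J (lower a j) = mergeSum c x J (lower a j) +
      1 / 2 * splitSum c (x - 2) J (lower a j) +
      if a j = 0 then corrOn c (x - 2) (J.erase j) a else 0 := by
    intro j hj
    split_ifs with haj
    · rw [hc.corrOn_lower_of_eq_zero hj haj, mergeSum_lower a hj, splitSum_lower a hj, haj,
        sum_eq_zero fun i hi => by
          rw [hc.corrOn_lower_of_eq_zero (mem_erase.2 ⟨(ne_of_mem_erase hi).symm, hj⟩) haj,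
            mul_zero],
        sum_eq_zero fun b _ => sum_eq_zero fun A _ => by
          split_ifs with hjA
          · rw [hc.corrOn_lower_of_eq_zero hjA haj, zero_mul]
          · rfl]
      rw [add_zero]
      push_cast
      ring
    · rw [add_zero]
      refine ih J hJI _ x hJ hx fun i hi => ?_
      rcases eq_or_ne i j with rfl | hij
      · have := haJ i hi
        rw [lower_self]
        omega
      · rw [lower_of_ne a hij]
        exact haJ i hi
  have hdef : stringDefect x J a = 0 := sum_eq_zero fun j _ => if_neg fun h => by omega
  rw [hc.string (by omega) hk hak haJ, hdef, hc.mergeSum_insert hx2 hk hak haJ,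
    hc.splitSum_insert (by omega) hk hak haJ, sum_congr rfl fun j hj => by rw [hlow j hj]]
  have hprev := ih J hJI a (x - 1) hJ (by omega) haJ
  have hsplit : ∑ j ∈ J, (2 * (a j : ℝ) + 1) * (mergeSum c x J (lower a j) +
      1 / 2 * splitSum c (x - 2) J (lower a j) +
      if a j = 0 then corrOn c (x - 2) (J.erase j) a else 0) =
      ∑ j ∈ J, (2 * (a j : ℝ) + 1) * (∑ i ∈ J.erase j,
        (2 * (a i : ℝ) + 1) * corrOn c (x + a i - 1) (J.erase i) (lower a j)) +
      ∑ j ∈ J, (2 * (a j : ℝ) + 1) * ((2 * (a j : ℝ) - 1) *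
        corrOn c (x + a j - 2) (J.erase j) a) +
      ∑ j ∈ J, (2 * (a j : ℝ) + 1) * (1 / 2 * splitSum c (x - 2) J (lower a j)) +
      ∑ j ∈ J, if a j = 0 then corrOn c (x - 2) (J.erase j) a else 0 := by
    simp only [← sum_add_distrib]
    refine sum_congr rfl fun j hj => ?_
    rw [mergeSum_lower a hj]
    split_ifs with haj
    · rw [haj]
      push_cast
      ring
    · ring
  have hmerge : 2 * (x : ℝ) * mergeSum c (x - 1) J a + ∑ j ∈ J, (2 * (a j : ℝ) + 1) *
        ((2 * (a j : ℝ) - 1) * corrOn c (x + a j - 2) (J.erase j) a) =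
      ∑ i ∈ J, (2 * (a i : ℝ) + 1) * ((2 * ((x + a i - 1 : ℤ) : ℝ) + 1) *
        corrOn c (x + a i - 2) (J.erase i) a) := by
    rw [mergeSum, mul_sum, ← sum_add_distrib]
    refine sum_congr rfl fun j _ => ?_
    rw [show x - 1 + a j - 1 = x + a j - 2 by ring]
    push_cast
    ring
  rw [hsplit, ← hmerge]
  rw [show x - 1 - 2 = x - 2 - 1 by ring] at hprev
  push_cast
  linear_combination 2 * (x : ℝ) * hprev

end GenusZero

theorem ttau_cons_restrictTo {τ : ℤ → (n : ℕ) → (Fin n → ℤ) → ℝ} (h : DVVFamily τ) (g b : ℤ)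
    {n : ℕ} (A : Finset (Fin n)) (a : Fin n → ℤ) :
    ttau τ g (#A + 1) (Fin.cons b (restrictTo A a)) = corrOn (corr τ g) b A a := by
  rw [ttau_eq_corr h, map_univ_cons, map_univ_restrictTo, corrOn]

theorem ttau_update {τ : ℤ → (n : ℕ) → (Fin n → ℤ) → ℝ} (h : DVVFamily τ) (g b : ℤ)
    {n : ℕ} (i : Fin n) (a : Fin n → ℤ) :
    ttau τ g n (Function.update a i b) =
      ttau τ g (#({i}ᶜ : Finset (Fin n)) + 1) (Fin.cons b (restrictTo {i}ᶜ a)) := by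
  rw [ttau_cons_restrictTo h, ttau_eq_corr h, map_univ_update, corrOn, compl_singleton]

/-- The coefficient of the splitting terms of the recursion. -/
noncomputable def splitCoeff (τ : ℤ → (n : ℕ) → (Fin n → ℤ) → ℝ) (g : ℤ) {n : ℕ}
    (a : Fin n → ℤ) (b b' : ℤ) : ℝ :=
  (if 1 ≤ g then ttau τ (g - 1) (n + 2) (Fin.cons b (Fin.cons b' a)) else 0) +
    ∑ g₁ ∈ Finset.Icc (0 : ℤ) g, ∑ A ∈ (univ : Finset (Fin n)).powerset,
      ttau τ g₁ (#A + 1) (Fin.cons b (restrictTo A a)) *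
        ttau τ (g - g₁) (#Aᶜ + 1) (Fin.cons b' (restrictTo Aᶜ a))

/-- The recursion for the correlators in which no correlator of negative genus occurs. -/
theorem dvv_stable {τ : ℤ → (n : ℕ) → (Fin n → ℤ) → ℝ} (h : DVVFamily τ)
    (hbase : τ 0 3 (fun _ => 0) = 1) {g : ℤ} {n : ℕ} (hg : 0 ≤ g) (hgn : 3 ≤ 2 * g + (n : ℤ))
    (a₀ : ℤ) (a : Fin n → ℤ) (ha₀ : 0 ≤ a₀) (ha : ∀ i, 0 ≤ a i) :
    ttau τ g (n + 1) (Fin.cons a₀ a) =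
      (∑ i, (2 * (a i : ℝ) + 1) * ttau τ g (#({i}ᶜ : Finset (Fin n)) + 1)
        (Fin.cons (a₀ + a i - 1) (restrictTo {i}ᶜ a))) +
      (1 / 2) * ∑ b ∈ Finset.Icc (0 : ℤ) (a₀ - 2),
        splitCoeff τ g a b (a₀ - 2 - b) := by
  unfold splitCoeff
  rcases eq_or_lt_of_le hg with rfl | hg1
  · have hc := genusZero_corr h hbase
    have hn : 3 ≤ #(univ : Finset (Fin n)) := by
      rw [card_fin]
      omega
    have hmain : corrOn (corr τ 0) a₀ univ a =
        mergeSum (corr τ 0) a₀ univ a + 1 / 2 * splitSum (corr τ 0) (a₀ - 2) univ a := by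
      rcases eq_or_lt_of_le ha₀ with rfl | ha₁
      · rw [hc.corrOn_low le_rfl zero_le_one hn fun i _ => ha i, splitSum,
          Finset.Icc_eq_empty (by norm_num), sum_empty, mul_zero, add_zero]
      · exact hc.recursion univ a a₀ (by omega) ha₁ fun i _ => ha i
    rw [ttau_eq_corr h, map_univ_cons]
    rw [corrOn] at hmain
    rw [hmain, mergeSum, splitSum]
    simp only [ttau_cons_restrictTo h, compl_singleton, Finset.Icc_self, sum_singleton, sub_zero,
      ← compl_eq_univ_sdiff, if_neg (show ¬(1 : ℤ) ≤ 0 by norm_num), zero_add]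
  · rw [h.dvv g n hg hgn a₀ a ha₀ ha]
    simp only [ttau_update h]
    congr 2
    refine sum_congr rfl fun b _ => ?_
    rw [if_pos (show 1 ≤ g from hg1)]
    congr 1
    refine sum_congr rfl fun g₁ hg₁ => sum_congr rfl fun A _ => ?_
    rw [Finset.mem_Icc] at hg₁
    split_ifs with hst
    · rfl
    · rcases not_and_or.1 hst with h1 | h1
      · rw [ttau_eq_zero h, zero_mul]
        rintro ⟨-, h2, -⟩
        push_cast at h2
        omega
      · rw [mul_comm, ttau_eq_zero h, zero_mul]
        rintro ⟨-, h2, -⟩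
        push_cast at h2
        omega

theorem nonneg_of_cons {m : ℕ} {b : ℤ} {a : Fin m → ℤ}
    (h : ∀ i, 0 ≤ (Fin.cons b a : Fin (m + 1) → ℤ) i) : 0 ≤ b ∧ ∀ i, 0 ≤ a i :=
  ⟨h 0, fun i => h i.succ⟩

theorem le_of_ttau_cons_ne_zero {τ : ℤ → (n : ℕ) → (Fin n → ℤ) → ℝ} (h : DVVFamily τ) {g : ℤ}
    {m : ℕ} {b : ℤ} {a : Fin m → ℤ} (hne : ttau τ g (m + 1) (Fin.cons b a) ≠ 0) :
    0 ≤ b ∧ b ≤ 3 * g - 2 + m := by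
  by_contra hb
  refine hne (ttau_eq_zero h fun ⟨h1, _, h3⟩ => hb ?_)
  obtain ⟨hb0, ha⟩ := nonneg_of_cons h1
  rw [Fin.sum_univ_succ, Fin.cons_zero] at h3
  simp only [Fin.cons_succ] at h3
  have := sum_nonneg fun i (_ : i ∈ univ) => ha i
  push_cast at h3
  constructor <;> omega

theorem splitCoeff_eq_zero {τ : ℤ → (n : ℕ) → (Fin n → ℤ) → ℝ} (h : DVVFamily τ) {g : ℤ}
    {n : ℕ} (a : Fin n → ℤ) {b b' : ℤ} (hb : 3 * g + n ≤ b + b' + 2) :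
    splitCoeff τ g a b b' = 0 := by
  have h1 : ttau τ (g - 1) (n + 2) (Fin.cons b (Fin.cons b' a)) = 0 := by
    refine ttau_eq_zero h fun ⟨h1, _, h3⟩ => ?_
    obtain ⟨-, h1'⟩ := nonneg_of_cons h1
    obtain ⟨-, ha⟩ := nonneg_of_cons h1'
    rw [Fin.sum_univ_succ, Fin.cons_zero] at h3
    simp only [Fin.cons_succ] at h3
    rw [Fin.sum_univ_succ, Fin.cons_zero] at h3
    simp only [Fin.cons_succ] at h3
    have := sum_nonneg fun i (_ : i ∈ univ) => ha i
    push_cast at h3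
    omega
  rw [splitCoeff, h1, ite_self, zero_add]
  refine sum_eq_zero fun g₁ _ => sum_eq_zero fun A _ => ?_
  by_contra hne
  obtain ⟨hl, hr⟩ := mul_ne_zero_iff.1 hne
  have hl' := (le_of_ttau_cons_ne_zero h hl).2
  have hr' := (le_of_ttau_cons_ne_zero h hr).2
  have hcard := card_add_card_compl A
  rw [Fintype.card_fin] at hcard
  omega

theorem restrictTo_singleton {n : ℕ} {α : Type*} (i : Fin n) (x : Fin n → α)
    (j : Fin #({i} : Finset (Fin n))) : restrictTo {i} x j = x i :=
  congrArg x (mem_singleton.1 (({i} : Finset (Fin n)).orderIsoOfFin rfl j).2)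

theorem sum_pi_singleton_split {n N : ℕ} (i : Fin n) {β : Type*} [AddCommMonoid β]
    (F : Fin N → (Fin #({i}ᶜ : Finset (Fin n)) → Fin N) → β) :
    ∑ a : Fin n → Fin N, F (a i) (restrictTo {i}ᶜ a) = ∑ x, ∑ a', F x a' := by
  have h0 : 0 < #({i} : Finset (Fin n)) := by simp
  have h := sum_pi_split (N := N) {i} fun α α' => F (α ⟨0, h0⟩) α'
  simp only [restrictTo_singleton] at h
  rw [h]
  refine sum_nbij' (fun α => α ⟨0, h0⟩) (fun x _ => x) (fun _ _ => mem_univ _)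
    (fun _ _ => mem_univ _) (fun α _ => ?_) (fun _ _ => rfl) (fun _ _ => rfl)
  ext j
  congr 2
  ext
  have := j.2
  simp only [card_singleton] at this
  simp only
  omega

theorem monomial_singleton_split {n N : ℕ} (i : Fin n) (z : Fin n → ℂ) (a : Fin n → Fin N) :
    monomial z a = (z i ^ (2 * (a i : ℕ) + 2))⁻¹ *
      monomial (restrictTo {i}ᶜ z) (restrictTo {i}ᶜ a) := by
  rw [monomial_split {i}]
  congr 1
  simp only [monomial, restrictTo_singleton, prod_const, card_fin, card_singleton, pow_one]

theorem sum_powerset_eq_sum_singleton {ι β : Type*} [Fintype ι] [AddCommMonoid β]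
    (f : Finset ι → β) (hf : ∀ A, #A ≠ 1 → f A = 0) :
    ∑ A ∈ (univ : Finset ι).powerset, f A = ∑ i, f {i} := by
  have h : ∑ i, f {i} = ∑ A ∈ univ.map ⟨fun i : ι => ({i} : Finset ι), singleton_injective⟩, f A := by
    rw [sum_map]
    rfl
  rw [h]
  refine (sum_subset (fun A _ => by simp) fun A _ hA => hf A fun h1 => hA ?_).symm
  obtain ⟨i, rfl⟩ := card_eq_one.1 h1
  exact mem_map_of_mem _ (mem_univ i)

theorem pairW_singleton {n : ℕ} (i : Fin n) (z : ℂ) (zs : Fin n → ℂ) :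
    pairW 0 (#({i} : Finset (Fin n)) + 1) (Fin.cons z (restrictTo {i} zs)) =
      1 / (z - zs i) ^ 2 := by
  rw [pairW, dif_pos ⟨rfl, by simp⟩]
  congr 3
  exact restrictTo_singleton i zs ⟨0, by simp⟩

theorem sum_pairW_mul {g : ℤ} (hg : 0 ≤ g) {n : ℕ} (z : ℂ) (zs : Fin n → ℂ)
    (Y : ℤ → Finset (Fin n) → ℂ) :
    ∑ g₁ ∈ Finset.Icc (0 : ℤ) g, ∑ A ∈ (univ : Finset (Fin n)).powerset,
      pairW g₁ (#A + 1) (Fin.cons z (restrictTo A zs)) * Y g₁ A =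
      ∑ i, 1 / (z - zs i) ^ 2 * Y 0 {i} := by
  rw [sum_eq_single_of_mem 0 (Finset.mem_Icc.2 ⟨le_rfl, hg⟩), sum_powerset_eq_sum_singleton]
  · simp only [pairW_singleton]
  · intro A hA
    rw [pairW, dif_neg (by omega), zero_mul]
  · intro g₁ _ hg₁
    refine sum_eq_zero fun A _ => ?_
    rw [pairW, dif_neg fun h => hg₁ h.1, zero_mul]

theorem sum_genus_compl {g : ℤ} {n : ℕ} (F : ℤ → Finset (Fin n) → ℂ) :
    ∑ g₁ ∈ Finset.Icc (0 : ℤ) g, ∑ A ∈ (univ : Finset (Fin n)).powerset, F (g - g₁) Aᶜ =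
      ∑ g₁ ∈ Finset.Icc (0 : ℤ) g, ∑ A ∈ (univ : Finset (Fin n)).powerset, F g₁ A := by
  refine sum_nbij' (fun b => g - b) (fun b => g - b) ?_ ?_ ?_ ?_ fun b _ => ?_
  · intro b hb
    rw [Finset.mem_Icc] at hb ⊢
    omega
  · intro b hb
    rw [Finset.mem_Icc] at hb ⊢
    omega
  · intro b _
    exact sub_sub_cancel g b
  · intro b _
    exact sub_sub_cancel g b
  · exact sum_nbij' (fun A => Aᶜ) (fun A => Aᶜ) (fun _ _ => by simp) (fun _ _ => by simp)
      (fun A _ => compl_compl A) (fun A _ => compl_compl A) fun _ _ => rfl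

theorem sum_mul_pairW {g : ℤ} (hg : 0 ≤ g) {n : ℕ} (z : ℂ) (zs : Fin n → ℂ)
    (Y : ℤ → Finset (Fin n) → ℂ) :
    ∑ g₁ ∈ Finset.Icc (0 : ℤ) g, ∑ A ∈ (univ : Finset (Fin n)).powerset,
      Y g₁ A * pairW (g - g₁) (#Aᶜ + 1) (Fin.cons z (restrictTo Aᶜ zs)) =
      ∑ i, 1 / (z - zs i) ^ 2 * Y g {i}ᶜ := by
  have h := sum_pairW_mul hg z zs fun g₁ A => Y (g - g₁) Aᶜ
  rw [sub_zero] at h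
  rw [← h, ← sum_genus_compl]
  refine sum_congr rfl fun g₁ _ => sum_congr rfl fun A _ => ?_
  rw [sub_sub_cancel, compl_compl, mul_comm]

/-- The function whose residues against the recursion kernel are taken. -/
noncomputable def recursionIntegrand (τ : ℤ → (n : ℕ) → (Fin n → ℤ) → ℝ) (g : ℤ) {n : ℕ}
    (zs : Fin n → ℂ) (z : ℂ) : ℂ :=
  tW τ (g - 1) (n + 2) (Fin.cons z (Fin.cons (-z) zs)) +
    ∑ g₁ ∈ Finset.Icc (0 : ℤ) g, ∑ A ∈ (univ : Finset (Fin n)).powerset,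
      tW τ g₁ (#A + 1) (Fin.cons z (restrictTo A zs)) *
        tW τ (g - g₁) (#Aᶜ + 1) (Fin.cons (-z) (restrictTo Aᶜ zs))

theorem tW_cons_cons_neg {τ : ℤ → (n : ℕ) → (Fin n → ℤ) → ℝ} (h : DVVFamily τ) {g : ℤ} {n : ℕ}
    (hgn : 3 ≤ 2 * g + (n : ℤ)) {N : ℕ} (hN : (N : ℤ) = 3 * g + n) (zs : Fin n → ℂ) (z : ℂ) :
    tW τ (g - 1) (n + 2) (Fin.cons z (Fin.cons (-z) zs)) =
      ∑ p : (Fin n → Fin N) × Fin N × Fin N,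
        ((if 1 ≤ g then ttau τ (g - 1) (n + 2) (Fin.cons ((p.2.1 : ℕ) : ℤ)
          (Fin.cons ((p.2.2 : ℕ) : ℤ) (toIndex p.1))) else 0 : ℝ) : ℂ) * monomial zs p.1 *
          (z ^ (2 * ((p.2.1 : ℕ) + (p.2.2 : ℕ) + 2)))⁻¹ := by
  by_cases hg1 : 1 ≤ g
  · simp only [if_pos hg1]
    rw [tW_eq_stableW_add_pairW h (N := N) (by omega) (by push_cast; omega) (by omega), pairW,
      dif_neg (by omega), add_zero, stableW_cons_cons_neg]
  · rw [tW, dif_neg (by omega), if_neg (by omega)]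
    simp [hg1]

theorem recursionIntegrand_eq {τ : ℤ → (n : ℕ) → (Fin n → ℤ) → ℝ} (h : DVVFamily τ) {g : ℤ}
    {n : ℕ} (hg : 0 ≤ g) (hgn : 3 ≤ 2 * g + (n : ℤ)) {N : ℕ} (hN : (N : ℤ) = 3 * g + n)
    (zs : Fin n → ℂ) (z : ℂ) :
    recursionIntegrand τ g zs z =
      ∑ p : (Fin n → Fin N) × Fin N × Fin N,
        (splitCoeff τ g (toIndex p.1) (p.2.1 : ℕ) (p.2.2 : ℕ) : ℂ) * monomial zs p.1 *
          (z ^ (2 * ((p.2.1 : ℕ) + (p.2.2 : ℕ) + 2)))⁻¹ +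
      ∑ i, ∑ b : Fin N, ∑ a : Fin #({i}ᶜ : Finset (Fin n)) → Fin N,
        (ttau τ g (#({i}ᶜ : Finset (Fin n)) + 1) (Fin.cons ((b : ℕ) : ℤ) (toIndex a)) : ℂ) *
          monomial (restrictTo {i}ᶜ zs) a *
          ((1 / (z - zs i) ^ 2 + 1 / (-z - zs i) ^ 2) * (z ^ (2 * ((b : ℕ) + 1)))⁻¹) := by
  have hexp : ∑ g₁ ∈ Finset.Icc (0 : ℤ) g, ∑ A ∈ (univ : Finset (Fin n)).powerset,
      tW τ g₁ (#A + 1) (Fin.cons z (restrictTo A zs)) *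
        tW τ (g - g₁) (#Aᶜ + 1) (Fin.cons (-z) (restrictTo Aᶜ zs)) =
      ∑ g₁ ∈ Finset.Icc (0 : ℤ) g, ∑ A ∈ (univ : Finset (Fin n)).powerset,
        stableW τ N g₁ (#A + 1) (Fin.cons z (restrictTo A zs)) *
          stableW τ N (g - g₁) (#Aᶜ + 1) (Fin.cons (-z) (restrictTo Aᶜ zs)) +
      (∑ g₁ ∈ Finset.Icc (0 : ℤ) g, ∑ A ∈ (univ : Finset (Fin n)).powerset,
        pairW g₁ (#A + 1) (Fin.cons z (restrictTo A zs)) *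
          stableW τ N (g - g₁) (#Aᶜ + 1) (Fin.cons (-z) (restrictTo Aᶜ zs)) +
      ∑ g₁ ∈ Finset.Icc (0 : ℤ) g, ∑ A ∈ (univ : Finset (Fin n)).powerset,
        stableW τ N g₁ (#A + 1) (Fin.cons z (restrictTo A zs)) *
          pairW (g - g₁) (#Aᶜ + 1) (Fin.cons (-z) (restrictTo Aᶜ zs))) := by
    simp only [← sum_add_distrib]
    refine sum_congr rfl fun g₁ hg₁ => sum_congr rfl fun A _ => ?_
    rw [Finset.mem_Icc] at hg₁
    have hcard := card_add_card_compl A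
    rw [Fintype.card_fin] at hcard
    rw [tW_eq_stableW_add_pairW h (N := N) hg₁.1 (by push_cast; omega) (by omega),
      tW_eq_stableW_add_pairW h (N := N) (g := g - g₁) (by omega) (by push_cast; omega) (by omega)]
    have hpp : pairW g₁ (#A + 1) (Fin.cons z (restrictTo A zs)) *
        pairW (g - g₁) (#Aᶜ + 1) (Fin.cons (-z) (restrictTo Aᶜ zs)) = 0 := by
      by_cases h1 : g₁ = 0 ∧ #A + 1 = 2
      · rw [mul_comm, pairW, dif_neg (by omega), zero_mul]
      · rw [pairW, dif_neg h1, zero_mul]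
    linear_combination hpp
  rw [recursionIntegrand, hexp, tW_cons_cons_neg h hgn hN,
    sum_pairW_mul hg z zs fun g₁ A =>
      stableW τ N (g - g₁) (#Aᶜ + 1) (Fin.cons (-z) (restrictTo Aᶜ zs)),
    sum_mul_pairW hg (-z) zs fun g₁ A => stableW τ N g₁ (#A + 1) (Fin.cons z (restrictTo A zs)),
    ← add_assoc]
  congr 1
  · simp only [stableW_mul_stableW]
    rw [sum_congr rfl fun g₁ _ => sum_comm, sum_comm, ← sum_add_distrib]
    refine sum_congr rfl fun p _ => ?_
    rw [splitCoeff]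
    push_cast
    simp only [add_mul, sum_mul]
  · rw [← sum_add_distrib]
    refine sum_congr rfl fun i _ => ?_
    rw [sub_zero, stableW_cons_neg, ← add_mul, stableW_cons, mul_sum]
    refine sum_congr rfl fun b _ => ?_
    rw [mul_sum]
    refine sum_congr rfl fun a _ => ?_
    rw [mul_add_one 2 (b : ℕ)]
    ring

theorem sum_split_terms {τ : ℤ → (n : ℕ) → (Fin n → ℤ) → ℝ} (h : DVVFamily τ) {g : ℤ} {n : ℕ}
    {N : ℕ} (hN : (N : ℤ) = 3 * g + n) (zs : Fin n → ℂ) (φ : ℕ → ℂ) :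
    ∑ m : Fin N, ∑ a : Fin n → Fin N,
      (1 / 2 * ∑ b ∈ Finset.Icc (0 : ℤ) (((m : ℕ) : ℤ) - 2),
        (splitCoeff τ g (toIndex a) b (((m : ℕ) : ℤ) - 2 - b) : ℂ)) * monomial zs a * φ m =
      ∑ p : (Fin n → Fin N) × Fin N × Fin N,
        (splitCoeff τ g (toIndex p.1) (p.2.1 : ℕ) (p.2.2 : ℕ) : ℂ) * monomial zs p.1 *
          (1 / 2 * φ ((p.2.1 : ℕ) + (p.2.2 : ℕ) + 2)) := by
  rw [sum_comm, Fintype.sum_prod_type]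
  refine sum_congr rfl fun a _ => ?_
  have := sum_fin_split (N := N) (C := fun b b' => (splitCoeff τ g (toIndex a) b b' : ℂ)) φ
    fun x y hxy => by rw [splitCoeff_eq_zero h _ (by omega), Complex.ofReal_zero]
  rw [Fintype.sum_prod_type]
  calc _ = 1 / 2 * monomial zs a * ∑ m : Fin N, φ m *
        ∑ b ∈ Finset.Icc (0 : ℤ) (((m : ℕ) : ℤ) - 2),
          (splitCoeff τ g (toIndex a) b (((m : ℕ) : ℤ) - 2 - b) : ℂ) := by
        rw [mul_sum]
        refine sum_congr rfl fun m _ => ?_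
        ring
    _ = _ := by
        rw [this, mul_sum]
        refine sum_congr rfl fun x _ => ?_
        rw [mul_sum]
        refine sum_congr rfl fun y _ => ?_
        ring

theorem sum_merge_terms {τ : ℤ → (n : ℕ) → (Fin n → ℤ) → ℝ} (h : DVVFamily τ) {g : ℤ} {n : ℕ}
    {N : ℕ} (hN : (N : ℤ) = 3 * g + n) (zs : Fin n → ℂ) (φ : ℕ → ℂ) (i : Fin n) :
    ∑ m : Fin N, ∑ a : Fin n → Fin N,
      (2 * ((a i : ℕ) : ℂ) + 1) * (ttau τ g (#({i}ᶜ : Finset (Fin n)) + 1)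
        (Fin.cons (((m : ℕ) : ℤ) + ((a i : ℕ) : ℤ) - 1) (restrictTo {i}ᶜ (toIndex a))) : ℂ) *
          monomial zs a * φ m =
      ∑ b : Fin N, ∑ a : Fin #({i}ᶜ : Finset (Fin n)) → Fin N,
        (ttau τ g (#({i}ᶜ : Finset (Fin n)) + 1) (Fin.cons ((b : ℕ) : ℤ) (toIndex a)) : ℂ) *
          monomial (restrictTo {i}ᶜ zs) a *
          ∑ k ∈ antidiagonal ((b : ℕ) + 1),
            (2 * k.1 + 1) * (zs i ^ (2 * k.1 + 2))⁻¹ * φ k.2 := by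
  have hsplit : ∀ m : Fin N, ∑ a : Fin n → Fin N,
      (2 * ((a i : ℕ) : ℂ) + 1) * (ttau τ g (#({i}ᶜ : Finset (Fin n)) + 1)
        (Fin.cons (((m : ℕ) : ℤ) + ((a i : ℕ) : ℤ) - 1) (restrictTo {i}ᶜ (toIndex a))) : ℂ) *
          monomial zs a * φ m =
      ∑ x : Fin N, ∑ a : Fin #({i}ᶜ : Finset (Fin n)) → Fin N,
        (2 * ((x : ℕ) : ℂ) + 1) * (zs i ^ (2 * (x : ℕ) + 2))⁻¹ * φ m *
          ((ttau τ g (#({i}ᶜ : Finset (Fin n)) + 1)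
            (Fin.cons (((m : ℕ) : ℤ) + ((x : ℕ) : ℤ) - 1) (toIndex a)) : ℂ) *
          monomial (restrictTo {i}ᶜ zs) a) := by
    intro m
    rw [← sum_pi_singleton_split]
    refine sum_congr rfl fun a _ => ?_
    rw [monomial_singleton_split i]
    change (2 * ((a i : ℕ) : ℂ) + 1) * (ttau τ g (#({i}ᶜ : Finset (Fin n)) + 1)
        (Fin.cons (((m : ℕ) : ℤ) + ((a i : ℕ) : ℤ) - 1) (toIndex (restrictTo {i}ᶜ a))) : ℂ) *
          _ * φ m = _
    ring
  have hcard : (#({i}ᶜ : Finset (Fin n)) : ℤ) + 1 = n := by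
    have := card_add_card_compl ({i} : Finset (Fin n))
    rw [Fintype.card_fin, card_singleton] at this
    omega
  simp only [hsplit]
  rw [sum_congr rfl fun m _ => sum_comm, sum_comm, sum_comm (s := (univ : Finset (Fin N)))]
  refine sum_congr rfl fun a _ => ?_
  refine sum_fin_fin_merge (N := N)
    (f := fun b => (ttau τ g (#({i}ᶜ : Finset (Fin n)) + 1) (Fin.cons b (toIndex a)) : ℂ) *
      monomial (restrictTo {i}ᶜ zs) a)
    (fun m x => (2 * (x : ℂ) + 1) * (zs i ^ (2 * x + 2))⁻¹ * φ m) ?_ fun b hb => ?_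
  · by_contra hne
    have := (le_of_ttau_cons_ne_zero h
      (Complex.ofReal_ne_zero.1 (left_ne_zero_of_mul hne))).1
    omega
  · by_contra hne
    have := (le_of_ttau_cons_ne_zero h
      (Complex.ofReal_ne_zero.1 (left_ne_zero_of_mul hne))).2
    omega

theorem hasKernelResidue_recursionIntegrand {τ : ℤ → (n : ℕ) → (Fin n → ℤ) → ℝ}
    (h : DVVFamily τ) (hbase : τ 0 3 (fun _ => 0) = 1) {g : ℤ} {n : ℕ} (hg : 0 ≤ g)
    (hgn : 3 ≤ 2 * g + (n : ℤ)) {ε : ℝ} (hε : 0 < ε) {z₀ : ℂ} (hz₀ : ε < ‖z₀‖) {zs : Fin n → ℂ}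
    (hzs : ∀ i, ε < ‖zs i‖) :
    HasKernelResidue ε z₀ (recursionIntegrand τ g zs) (tW τ g (n + 1) (Fin.cons z₀ zs)) := by
  obtain ⟨N, hN⟩ : ∃ N : ℕ, (N : ℤ) = 3 * g + n := ⟨(3 * g + n).toNat, by omega⟩
  have hintegral := (HasKernelResidue.sum (s := univ)
    fun (p : (Fin n → Fin N) × Fin N × Fin N) _ =>
    (hasKernelResidue_inv_pow hε hz₀ ((p.2.1 : ℕ) + (p.2.2 : ℕ) + 2)).const_mul
      ((splitCoeff τ g (toIndex p.1) (p.2.1 : ℕ) (p.2.2 : ℕ) : ℂ) * monomial zs p.1)).add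
    (HasKernelResidue.sum (s := univ) fun (i : Fin n) _ =>
      HasKernelResidue.sum (s := univ) fun (b : Fin N) _ =>
      HasKernelResidue.sum (s := univ) fun (a : Fin #({i}ᶜ : Finset (Fin n)) → Fin N) _ =>
      (hasKernelResidue_bergman hε hz₀ (hzs i) ((b : ℕ) + 1)).const_mul
        ((ttau τ g (#({i}ᶜ : Finset (Fin n)) + 1) (Fin.cons ((b : ℕ) : ℤ) (toIndex a)) : ℂ) *
          monomial (restrictTo {i}ᶜ zs) a))
  rw [funext (recursionIntegrand_eq h hg hgn hN zs)]
  convert! hintegral using 1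
  rw [tW_eq_stableW_add_pairW h (N := N) hg (by push_cast; omega) (by omega), pairW,
    dif_neg (by omega), add_zero, stableW_cons, ← sum_split_terms h hN zs
      fun m => (z₀ ^ (2 * m + 2))⁻¹,
    ← sum_congr rfl fun i _ => sum_merge_terms h hN zs (fun m => (z₀ ^ (2 * m + 2))⁻¹) i,
    sum_comm (s := (univ : Finset (Fin n))), ← sum_add_distrib]
  refine sum_congr rfl fun m _ => ?_
  rw [sum_comm (s := (univ : Finset (Fin n))), ← sum_add_distrib]
  refine sum_congr rfl fun a _ => ?_
  rw [dvv_stable h hbase hg hgn _ (toIndex a) (by positivity) fun i => by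
    simp only [toIndex]; positivity]
  simp only [← sum_mul, ← add_mul]
  congr 2
  rw [add_comm]
  push_cast
  simp only [toIndex, Int.cast_natCast]

theorem tW_zero_three {τ : ℤ → (n : ℕ) → (Fin n → ℤ) → ℝ} (h : DVVFamily τ)
    (hbase : τ 0 3 (fun _ => 0) = 1) (z : Fin 3 → ℂ) :
    tW τ 0 3 z = (z 0 ^ 2)⁻¹ * (z 1 ^ 2)⁻¹ * (z 2 ^ 2)⁻¹ := by
  rw [tW_eq_stableW_add_pairW h (N := 1) le_rfl (by norm_num) one_pos, pairW,
    dif_neg (by omega), add_zero, stableW, Fintype.sum_unique]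
  have : toIndex (default : Fin 3 → Fin 1) = fun _ => 0 := rfl
  rw [this, ttau, hbase]
  simp [monomial, dfac, Fin.prod_univ_three]
  ring

theorem tW_one_one {τ : ℤ → (n : ℕ) → (Fin n → ℤ) → ℝ} (h : DVVFamily τ)
    (hbase : τ 1 1 (fun _ => 1) = 1 / 24) (z : Fin 1 → ℂ) :
    tW τ 1 1 z = 1 / 8 * (z 0 ^ 4)⁻¹ := by
  rw [tW_eq_stableW_add_pairW h (N := 2) (by norm_num) (by norm_num) (by norm_num), pairW,
    dif_neg (by omega), add_zero, stableW, ← (Equiv.funUnique (Fin 1) (Fin 2)).symm.sum_comp,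
    Fin.sum_univ_two, ttau_eq_zero h, Complex.ofReal_zero, zero_mul, zero_add]
  · have : (toIndex ((Equiv.funUnique (Fin 1) (Fin 2)).symm 1) : Fin 1 → ℤ) = fun _ => 1 := rfl
    rw [this, ttau, hbase]
    have hd : dfac (2 * 1 + 1) = 3 := by
      rw [dfac, show (2 * 1 + 1 : ℤ).toNat = 3 from rfl]
      norm_num [Nat.doubleFactorial]
    simp only [Fintype.prod_unique, hd, monomial]
    norm_num
  · simp [toIndex]

theorem tW_zero_eq_pairW (τ : ℤ → (n : ℕ) → (Fin n → ℤ) → ℝ) {m : ℕ} (hm : m ≤ 2)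
    (z : Fin m → ℂ) : tW τ 0 m z = pairW 0 m z := by
  rw [tW, pairW, if_neg (by omega)]

theorem recursionIntegrand_zero_two (τ : ℤ → (n : ℕ) → (Fin n → ℤ) → ℝ) (zs : Fin 2 → ℂ)
    (z : ℂ) :
    recursionIntegrand τ 0 zs z =
      1 / (z - zs 0) ^ 2 * (1 / (-z - zs 1) ^ 2) + 1 / (z - zs 1) ^ 2 * (1 / (-z - zs 0) ^ 2) := by
  have hneg : tW τ (0 - 1) (2 + 2) (Fin.cons z (Fin.cons (-z) zs)) = 0 := by
    rw [tW, dif_neg (by omega), if_neg (by omega)]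
  have hpair : ∑ g₁ ∈ Finset.Icc (0 : ℤ) 0, ∑ A ∈ (univ : Finset (Fin 2)).powerset,
      tW τ g₁ (#A + 1) (Fin.cons z (restrictTo A zs)) *
        tW τ (0 - g₁) (#Aᶜ + 1) (Fin.cons (-z) (restrictTo Aᶜ zs)) =
      ∑ g₁ ∈ Finset.Icc (0 : ℤ) 0, ∑ A ∈ (univ : Finset (Fin 2)).powerset,
        pairW g₁ (#A + 1) (Fin.cons z (restrictTo A zs)) *
          pairW (0 - g₁) (#Aᶜ + 1) (Fin.cons (-z) (restrictTo Aᶜ zs)) := by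
    rw [Finset.Icc_self, sum_singleton, sum_singleton, sub_zero]
    refine sum_congr rfl fun A _ => ?_
    have hcard := card_add_card_compl A
    rw [Fintype.card_fin] at hcard
    rcases (by omega : #A = 0 ∨ #A = 1 ∨ #Aᶜ = 0) with h | h | h
    · rw [tW_zero_eq_pairW τ (by omega), pairW, dif_neg (by omega), zero_mul, zero_mul]
    · rw [tW_zero_eq_pairW τ (by omega), tW_zero_eq_pairW τ (by omega)]
    · rw [mul_comm, tW_zero_eq_pairW τ (by omega), mul_comm (pairW _ (#A + 1) _), pairW,
        dif_neg (by omega), zero_mul, zero_mul]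
  rw [recursionIntegrand, hneg, zero_add, hpair,
    sum_pairW_mul le_rfl z zs fun g₁ A =>
      pairW (0 - g₁) (#Aᶜ + 1) (Fin.cons (-z) (restrictTo Aᶜ zs)), Fin.sum_univ_two, sub_zero,
    show ({0}ᶜ : Finset (Fin 2)) = {1} from rfl, show ({1}ᶜ : Finset (Fin 2)) = {0} from rfl,
    pairW_singleton, pairW_singleton]

theorem recursionIntegrand_one_zero (τ : ℤ → (n : ℕ) → (Fin n → ℤ) → ℝ) (zs : Fin 0 → ℂ)
    (z : ℂ) : recursionIntegrand τ 1 zs z = 1 / 4 * (z ^ (2 * 1))⁻¹ := by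
  have h1 : tW τ (1 - 1) (0 + 2) (Fin.cons z (Fin.cons (-z) zs)) = 1 / (z - -z) ^ 2 := by
    rw [tW, dif_pos ⟨by norm_num, by norm_num⟩]
    rfl
  rw [recursionIntegrand, h1, sum_eq_zero, add_zero, sub_neg_eq_add, ← two_mul, mul_pow, mul_one,
    one_div, mul_inv]
  · norm_num
  · intro g₁ hg₁
    rw [Finset.mem_Icc] at hg₁
    refine sum_eq_zero fun A _ => ?_
    have hcard := card_add_card_compl A
    rw [Fintype.card_fin] at hcard
    rcases (by omega : g₁ = 0 ∨ g₁ = 1) with rfl | rfl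
    · rw [tW_zero_eq_pairW τ (by omega), pairW, dif_neg (by omega), zero_mul]
    · rw [mul_comm, sub_self, tW_zero_eq_pairW τ (by omega), pairW, dif_neg (by omega), zero_mul]

theorem circleIntegral_kernel_mul {ε : ℝ} (hε : 0 < ε) {z₀ : ℂ} (hz₀ : ε < ‖z₀‖) {f : ℂ → ℂ}
    (hf : DifferentiableOn ℂ f (closedBall 0 ε)) :
    1 / (2 * (Real.pi : ℂ) * Complex.I) *
      (∮ z in C(0, ε), 1 / (2 * z * (z₀ ^ 2 - z ^ 2)) * f z) = 1 / 2 * (z₀ ^ 2)⁻¹ * f 0 := by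
  have hne : ∀ z ∈ closedBall (0 : ℂ) ε, 2 * (z₀ ^ 2 - z ^ 2) ≠ 0 := by
    intro z hz h0
    have hz' : ‖z‖ ≤ ε := by simpa using hz
    have hsq : ‖z₀‖ ^ 2 = ‖z‖ ^ 2 := by
      rw [← norm_pow, ← norm_pow, sub_eq_zero.1 ((mul_eq_zero.1 h0).resolve_left two_ne_zero)]
    have := (sq_lt_sq₀ (norm_nonneg z) (norm_nonneg z₀)).2 (hz'.trans_lt hz₀)
    exact this.ne' hsq
  have hdiff : DifferentiableOn ℂ (fun z => (2 * (z₀ ^ 2 - z ^ 2))⁻¹ * f z) (closedBall 0 ε) := by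
    refine DifferentiableOn.mul (DifferentiableOn.inv ?_ hne) hf
    fun_prop
  have hcauchy := hdiff.circleIntegral_sub_inv_smul (mem_ball_self hε)
  have heq : (fun z => 1 / (2 * z * (z₀ ^ 2 - z ^ 2)) * f z) =
      fun z => (z - 0)⁻¹ • ((2 * (z₀ ^ 2 - z ^ 2))⁻¹ * f z) := by
    ext z
    rw [smul_eq_mul, sub_zero, one_div, ← mul_assoc, ← mul_inv]
    congr 2
    ring
  rw [heq, hcauchy, smul_eq_mul, ← mul_assoc, one_div_mul_cancel Complex.two_pi_I_ne_zero,
    one_mul, mul_inv, zero_pow two_ne_zero, sub_zero, one_div]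

theorem tW_recursion_zero_two {τ : ℤ → (n : ℕ) → (Fin n → ℤ) → ℝ} (h : DVVFamily τ)
    (hbase3 : τ 0 3 (fun _ => 0) = 1) {ε : ℝ} (hε : 0 < ε) {z₀ : ℂ} (hε₀ : ε < ‖z₀‖)
    {zs : Fin 2 → ℂ} (hεs : ∀ i, ε < ‖zs i‖) :
    tW τ 0 (2 + 1) (Fin.cons z₀ zs) = 1 / (2 * (Real.pi : ℂ) * Complex.I) *
      ∮ z in C(0, ε), 1 / (2 * z * (z₀ ^ 2 - z ^ 2)) * recursionIntegrand τ 0 zs z := by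
  have hpos : ∀ i, DifferentiableOn ℂ (fun z => 1 / (z - zs i) ^ 2) (closedBall 0 ε) := by
    intro i
    refine (differentiableOn_const 1).div ((differentiableOn_id.sub_const (zs i)).pow 2) ?_
    intro z hz
    refine pow_ne_zero 2 fun h0 => not_lt.2 (mem_closedBall_zero_iff.1 hz) ?_
    rw [show z = zs i from sub_eq_zero.1 h0]
    exact hεs i
  have hneg : ∀ i, DifferentiableOn ℂ (fun z => 1 / (-z - zs i) ^ 2) (closedBall 0 ε) := by
    intro i
    refine (differentiableOn_const 1).div ((differentiableOn_id.neg.sub_const (zs i)).pow 2) ?_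
    intro z hz
    refine pow_ne_zero 2 fun h0 => not_lt.2 (mem_closedBall_zero_iff.1 hz) ?_
    rw [← norm_neg, show -z = zs i from sub_eq_zero.1 h0]
    exact hεs i
  have hintegral := circleIntegral_kernel_mul hε hε₀
    (((hpos 0).mul (hneg 1)).add ((hpos 1).mul (hneg 0)))
  have heq : recursionIntegrand τ 0 zs =
      (fun z => 1 / (z - zs 0) ^ 2) * (fun z => 1 / (-z - zs 1) ^ 2) +
        (fun z => 1 / (z - zs 1) ^ 2) * (fun z => 1 / (-z - zs 0) ^ 2) :=
    funext fun z => recursionIntegrand_zero_two τ zs z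
  rw [heq, hintegral, tW_zero_three h hbase3]
  simp only [Pi.add_apply, Pi.mul_apply, zero_sub, neg_zero, even_two.neg_pow, one_div]
  rw [show (1 : Fin 3) = Fin.succ 0 from rfl, show (2 : Fin 3) = Fin.succ 1 from rfl,
    Fin.cons_zero, Fin.cons_succ, Fin.cons_succ]
  ring

theorem tW_recursion_one_zero {τ : ℤ → (n : ℕ) → (Fin n → ℤ) → ℝ} (h : DVVFamily τ)
    (hbase1 : τ 1 1 (fun _ => 1) = 1 / 24) {ε : ℝ} (hε : 0 < ε) {z₀ : ℂ} (hε₀ : ε < ‖z₀‖)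
    (zs : Fin 0 → ℂ) :
    tW τ 1 (0 + 1) (Fin.cons z₀ zs) = 1 / (2 * (Real.pi : ℂ) * Complex.I) *
      ∮ z in C(0, ε), 1 / (2 * z * (z₀ ^ 2 - z ^ 2)) * recursionIntegrand τ 1 zs z := by
  have heq : recursionIntegrand τ 1 zs = fun z => 1 / 4 * (z ^ (2 * 1))⁻¹ :=
    funext fun z => recursionIntegrand_one_zero τ zs z
  rw [heq, ((hasKernelResidue_inv_pow hε hε₀ 1).const_mul (1 / 4)).2, tW_one_one h hbase1,
    Fin.cons_zero]
  ring

end AiryRecursion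

/-- The Eynard–Orantin topological recursion for the Airy curve holds for the
generating functions `tW_{g,n}` of intersection numbers (Theorem 2.1 of the paper),
with the residue at `z = 0` written as a contour integral over a small circle `|z| = ε`. -/
theorem tW_eynard_orantin_recursion (τ : ℤ → (n : ℕ) → (Fin n → ℤ) → ℝ) (h : DVVFamily τ)
    (hbase3 : τ 0 3 (fun _ => 0) = 1) (hbase1 : τ 1 1 (fun _ => 1) = 1 / 24)
    (g n : ℕ) (hgn : 0 < 2 * (g : ℤ) - 1 + (n : ℤ))
    (z₀ : ℂ) (hz₀ : z₀ ≠ 0) (zs : Fin n → ℂ) (hzs : ∀ i, zs i ≠ 0)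
    (ε : ℝ) (hε : 0 < ε) (hε₀ : ε < ‖z₀‖) (hεs : ∀ i, ε < ‖zs i‖) :
    tW τ g (n + 1) (Fin.cons z₀ zs) =
      (1 / (2 * (Real.pi : ℂ) * Complex.I)) *
        ∮ z in C(0, ε), (1 / (2 * z * (z₀ ^ 2 - z ^ 2))) *
          (tW τ ((g : ℤ) - 1) (n + 2) (Fin.cons z (Fin.cons (-z) zs))
           + ∑ g₁ ∈ Finset.Icc (0 : ℤ) (g : ℤ),
               ∑ A ∈ (Finset.univ : Finset (Fin n)).powerset,
                 tW τ g₁ (A.card + 1) (Fin.cons z (fun j => zs (A.orderIsoOfFin rfl j).1))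
                 * tW τ ((g : ℤ) - g₁) ((Aᶜ).card + 1)
                     (Fin.cons (-z) (fun j => zs ((Aᶜ).orderIsoOfFin rfl j).1))) := by
  change _ = 1 / (2 * (Real.pi : ℂ) * Complex.I) *
    ∮ z in C(0, ε), 1 / (2 * z * (z₀ ^ 2 - z ^ 2)) * AiryRecursion.recursionIntegrand τ g zs z
  by_cases h3 : 3 ≤ 2 * (g : ℤ) + (n : ℤ)
  · exact (AiryRecursion.hasKernelResidue_recursionIntegrand h hbase3 (by omega) h3 hε hε₀
      hεs).2.symm
  obtain ⟨rfl, rfl⟩ | ⟨rfl, rfl⟩ : g = 0 ∧ n = 2 ∨ g = 1 ∧ n = 0 := by omega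
  · exact AiryRecursion.tW_recursion_zero_two h hbase3 hε hε₀ hεs
  · exact AiryRecursion.tW_recursion_one_zero h hbase1 hε hε₀ zs
end
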